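/- arXiv:2108.12389 — 2 statements merged into one kernel-verified Lean document; each statement's English description precedes it below -/
import Mathlib

section
/- Let Γ₁ = ℝ[x,y]/(xy − 1), Γ₂ = ℝ[x,y]/(x² + y² − 1), Γ₃ = ℝ[x,y]/(x² + y² + 1). The six ℝ-algebras Γ₁ ⊗_ℝ Γ₁, Γ₁ ⊗_ℝ Γ₂, Γ₁ ⊗_ℝ Γ₃, Γ₂ ⊗_ℝ Γ₂, Γ₃ ⊗_ℝ Γ₃, and the localization ℝ[x,y][(x² + y²)⁻¹] (the coordinate ring of 𝔸²_ℝ ∖ {x² + y² = 0}) are pairwise non-isomorphic, the complexification of each is isomorphic as a ℂ-algebra to the Laurent polynomial ring in two variables ℂ[T₁^{±1}, T₂^{±1}], and every commutative ℝ-algebra whose complexification is isomorphic to ℂ[T₁^{±1}, T₂^{±1}] as a ℂ-algebra is isomorphic to one of these six. Moreover Γ₂ ⊗_ℝ Γ₃ is isomorphic to Γ₃ ⊗_ℝ Γ₃. (Thus the surface (𝔸¹_ℂ ∖ {0})² has exactly six isomorphism classes of real forms.) -/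
open MvPolynomial
open scoped TensorProduct

/-- The defining polynomials of the three real conics `xy = 1`, `x² + y² = 1`,
`x² + y² = -1`. -/
noncomputable def conic13 : Fin 3 → MvPolynomial (Fin 2) ℝ :=
  ![X 0 * X 1 - 1,
    X 0 ^ 2 + X 1 ^ 2 - 1,
    X 0 ^ 2 + X 1 ^ 2 + 1]

/-- The coordinate rings `Γ₁, Γ₂, Γ₃` of the three real forms of `𝔸¹_ℂ ∖ {0}`. -/
noncomputable abbrev Gamma (i : Fin 3) :=
  MvPolynomial (Fin 2) ℝ ⧸ Ideal.span {conic13 i}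

/-- The coordinate ring of `𝔸²_ℝ ∖ {x² + y² = 0}`. -/
noncomputable abbrev PuncturedPlane :=
  Localization.Away ((X 0) ^ 2 + (X 1) ^ 2 : MvPolynomial (Fin 2) ℝ)

/-- `A` is a real form of the two-variable Laurent polynomial ring
`ℂ[T₁^{±1}, T₂^{±1}]`, the coordinate ring of `(𝔸¹_ℂ ∖ {0})²`. -/
def IsRealFormTorus (A : Type) [CommRing A] [Algebra ℝ A] : Prop :=
  Nonempty ((ℂ ⊗[ℝ] A) ≃ₐ[ℂ] AddMonoidAlgebra ℂ (ℤ × ℤ))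

/-- `A` and `B` are non-isomorphic real algebras. -/
def NotIso (A B : Type) [CommRing A] [Algebra ℝ A] [CommRing B] [Algebra ℝ B] : Prop :=
  IsEmpty (A ≃ₐ[ℝ] B)



/-- The Laurent polynomial ring in two variables. -/
abbrev TL := AddMonoidAlgebra ℂ (ℤ × ℤ)

/-- monomials -/
noncomputable abbrev mo (m : ℤ × ℤ) (z : ℂ) : TL := AddMonoidAlgebra.single m z

theorem unit_mo (f : TL) (hf : IsUnit f) : ∃ m z, z ≠ 0 ∧ f = mo m z := by
  classical
  obtain ⟨g, hg⟩ := hf.exists_right_inv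
  have hf0 : f ≠ 0 := by rintro rfl; simp at hg
  have hg0 : g ≠ 0 := by rintro rfl; simp at hg
  have hfs : f.coeff.support.Nonempty := by
    rw [Finsupp.support_nonempty_iff]; simpa using hf0
  have hgs : g.coeff.support.Nonempty := by
    rw [Finsupp.support_nonempty_iff]; simpa using hg0
  have hcard : ¬ (1 < f.coeff.support.card * g.coeff.support.card) := by
    intro h
    obtain ⟨p, hp, q, hq, hpq, h1, h2⟩ := TwoUniqueSums.uniqueAdd_of_one_lt_card h
    rw [Finset.mem_product] at hp hq
    have e1 := AddMonoidAlgebra.coeff_mul_add_of_uniqueAdd h1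
    have e2 := AddMonoidAlgebra.coeff_mul_add_of_uniqueAdd h2
    have n1 : f.coeff p.1 * g.coeff p.2 ≠ 0 :=
      mul_ne_zero (Finsupp.mem_support_iff.1 hp.1) (Finsupp.mem_support_iff.1 hp.2)
    have n2 : f.coeff q.1 * g.coeff q.2 ≠ 0 :=
      mul_ne_zero (Finsupp.mem_support_iff.1 hq.1) (Finsupp.mem_support_iff.1 hq.2)
    rw [← e1, hg, AddMonoidAlgebra.one_def, AddMonoidAlgebra.coeff_single,
      Finsupp.single_apply] at n1
    rw [← e2, hg, AddMonoidAlgebra.one_def, AddMonoidAlgebra.coeff_single,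
      Finsupp.single_apply] at n2
    have a1 : 0 = p.1 + p.2 := by by_contra h; simp [h] at n1
    have a2 : 0 = q.1 + q.2 := by by_contra h; simp [h] at n2
    have := h2 hp.1 hp.2 (a1.symm.trans a2)
    exact hpq (Prod.ext this.1 this.2)
  have h1 : f.coeff.support.card = 1 := by
    have a := Finset.card_pos.2 hfs
    have b := Finset.card_pos.2 hgs
    nlinarith
  obtain ⟨m, z, hz, h⟩ := Finsupp.card_support_eq_one'.1 h1
  refine ⟨m, z, hz, ?_⟩
  apply AddMonoidAlgebra.coeff_injective
  rw [h, AddMonoidAlgebra.coeff_single]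

theorem mo_mul (m n : ℤ × ℤ) (z w : ℂ) : mo m z * mo n w = mo (m + n) (z * w) :=
  AddMonoidAlgebra.single_mul_single ..

theorem mo_isUnit (m : ℤ × ℤ) {z : ℂ} (hz : z ≠ 0) : IsUnit (mo m z) := by
  refine IsUnit.of_mul_eq_one (mo (-m) z⁻¹) ?_
  rw [mo_mul, mul_inv_cancel₀ hz, add_neg_cancel]; rfl

theorem mo_inj {m n : ℤ × ℤ} {z w : ℂ} (hz : z ≠ 0) (h : mo m z = mo n w) : m = n ∧ z = w := by
  have := congrArg AddMonoidAlgebra.coeff h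
  rw [AddMonoidAlgebra.coeff_single, AddMonoidAlgebra.coeff_single] at this
  rcases Finsupp.single_eq_single_iff _ _ _ _ |>.1 this with h | h
  · exact h
  · exact absurd h.1 hz

theorem mhom_ext {R : Type*} [Monoid R] (f g : Multiplicative (ℤ × ℤ) →* R)
    (h1 : f (.ofAdd (1, 0)) = g (.ofAdd (1, 0))) (h2 : f (.ofAdd (0, 1)) = g (.ofAdd (0, 1))) :
    f = g := by
  have k1 : f.comp (AddMonoidHom.toMultiplicative (AddMonoidHom.inl ℤ ℤ)) =
      g.comp (AddMonoidHom.toMultiplicative (AddMonoidHom.inl ℤ ℤ)) :=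
    MonoidHom.ext_mint h1
  have k2 : f.comp (AddMonoidHom.toMultiplicative (AddMonoidHom.inr ℤ ℤ)) =
      g.comp (AddMonoidHom.toMultiplicative (AddMonoidHom.inr ℤ ℤ)) :=
    MonoidHom.ext_mint h2
  ext m
  obtain ⟨a, b⟩ := m
  have e : (Multiplicative.ofAdd ((a, b) : ℤ × ℤ)) =
    Multiplicative.ofAdd ((a, 0) : ℤ × ℤ) * Multiplicative.ofAdd ((0, b) : ℤ × ℤ) := by
    rw [← ofAdd_add]; simp
  change f (Multiplicative.ofAdd ((a, b) : ℤ × ℤ)) = g (Multiplicative.ofAdd ((a, b) : ℤ × ℤ))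
  rw [e, map_mul, map_mul]
  exact congrArg₂ _ (DFunLike.congr_fun k1 (Multiplicative.ofAdd a))
    (DFunLike.congr_fun k2 (Multiplicative.ofAdd b))

theorem tl_ringHom_ext {R : Type*} [Semiring R] (f g : TL →+* R)
    (h0 : ∀ z, f (mo 0 z) = g (mo 0 z))
    (h1 : f (mo (1, 0) 1) = g (mo (1, 0) 1)) (h2 : f (mo (0, 1) 1) = g (mo (0, 1) 1)) :
    f = g := by
  apply AddMonoidAlgebra.ringHom_ext'
  · ext z; exact h0 z
  · exact mhom_ext _ _ h1 h2

theorem mo_zero (z : ℂ) : mo 0 z = algebraMap ℂ TL z := rfl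

theorem tl_algHom_ext {R : Type*} [Semiring R] [Algebra ℂ R] (f g : TL →ₐ[ℂ] R)
    (h1 : f (mo (1, 0) 1) = g (mo (1, 0) 1)) (h2 : f (mo (0, 1) 1) = g (mo (0, 1) 1)) :
    f = g := by
  have := tl_ringHom_ext (f : TL →+* R) (g : TL →+* R) (by intro z; rw [mo_zero]; exact (f.commutes z).trans (g.commutes z).symm) h1 h2
  ext x
  · exact DFunLike.congr_fun this _

/-- monoid hom from two units -/
def unitsHom {R : Type*} [CommRing R] (u v : Rˣ) : Multiplicative (ℤ × ℤ) →* R where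
  toFun m := ((u ^ (m.toAdd.1) * v ^ (m.toAdd.2) : Rˣ) : R)
  map_one' := by simp
  map_mul' a b := by
    rw [← Units.val_mul]; congr 1
    simp only [toAdd_mul, Prod.fst_add, Prod.snd_add, zpow_add]
    exact mul_mul_mul_comm _ _ _ _

/-- universal property of the torus -/
noncomputable def tlLift {R : Type*} [CommRing R] [Algebra ℂ R] (u v : Rˣ) : TL →ₐ[ℂ] R :=
  AddMonoidAlgebra.lift ℂ R (ℤ × ℤ) (unitsHom u v)

theorem tlLift_mo {R : Type*} [CommRing R] [Algebra ℂ R] (u v : Rˣ) (m z) :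
    tlLift u v (mo m z) = z • ((u ^ m.1 * v ^ m.2 : Rˣ) : R) := by
  rw [tlLift, AddMonoidAlgebra.lift_single]; rfl

theorem tlLift_1 {R : Type*} [CommRing R] [Algebra ℂ R] (u v : Rˣ) :
    tlLift u v (mo (1, 0) 1) = u := by simp [tlLift_mo]

theorem tlLift_2 {R : Type*} [CommRing R] [Algebra ℂ R] (u v : Rˣ) :
    tlLift u v (mo (0, 1) 1) = v := by simp [tlLift_mo]


/-- monomial units -/
noncomputable def moU (m : ℤ × ℤ) (z : ℂ) (hz : z ≠ 0) : TLˣ :=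
  ⟨mo m z, mo (-m) z⁻¹, by rw [mo_mul, mul_inv_cancel₀ hz, add_neg_cancel]; rfl,
    by rw [mo_mul, inv_mul_cancel₀ hz, neg_add_cancel]; rfl⟩

theorem moU_zpow (m : ℤ × ℤ) (z : ℂ) (hz : z ≠ 0) (n : ℤ) :
    ((moU m z hz ^ n : TLˣ) : TL) = mo (n • m) (z ^ n) := by
  have : ∀ n : ℕ, ((moU m z hz ^ n : TLˣ) : TL) = mo (n • m) (z ^ n) := by
    intro n
    rw [Units.val_pow_eq_pow_val]
    exact AddMonoidAlgebra.single_pow ..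
  obtain ⟨n, rfl | rfl⟩ := n.eq_nat_or_neg
  · simpa using this n
  · rw [zpow_neg, zpow_natCast, zpow_neg, zpow_natCast, neg_smul, natCast_zsmul]
    have h2 : (moU m z hz ^ n) = moU (n • m) (z ^ n) (pow_ne_zero _ hz) :=
      Units.ext (this n)
    rw [h2]; rfl

theorem smul_mo (m : ℤ × ℤ) (z w : ℂ) : w • mo m z = mo m (w * z) := by
  simp [mo]

theorem tlLift_moU (p q : ℤ × ℤ) (α β : ℂ) (hα : α ≠ 0) (hβ : β ≠ 0) (m : ℤ × ℤ) (z : ℂ) :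
    tlLift (moU p α hα) (moU q β hβ) (mo m z) =
      mo (m.1 • p + m.2 • q) (z * (α ^ m.1 * β ^ m.2)) := by
  rw [tlLift_mo, Units.val_mul, moU_zpow, moU_zpow, mo_mul, smul_mo]

/-- complex conjugation on the complexification -/
noncomputable def tau (A : Type) [CommRing A] [Algebra ℝ A] : (ℂ ⊗[ℝ] A) →ₐ[ℝ] (ℂ ⊗[ℝ] A) :=
  Algebra.TensorProduct.map (Complex.conjAe : ℂ →ₐ[ℝ] ℂ) (AlgHom.id ℝ A)

section
variable {A B : Type} [CommRing A] [Algebra ℝ A] [CommRing B] [Algebra ℝ B]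

theorem tau_tmul (z : ℂ) (a : A) : tau A (z ⊗ₜ a) = (starRingEnd ℂ z) ⊗ₜ a := rfl

theorem tau_tau (x : ℂ ⊗[ℝ] A) : tau A (tau A x) = x := by
  induction x with
  | zero => simp
  | tmul z a => simp [tau_tmul]
  | add x y hx hy => rw [map_add, map_add, hx, hy]

theorem tau_algebraMap (z : ℂ) :
    tau A (algebraMap ℂ _ z) = algebraMap ℂ _ (starRingEnd ℂ z) := rfl

theorem exists_decomp (x : ℂ ⊗[ℝ] A) :
    ∃ a b : A, x = (1 : ℂ) ⊗ₜ a + Complex.I ⊗ₜ b := by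
  induction x with
  | zero => exact ⟨0, 0, by simp⟩
  | tmul z a =>
    refine ⟨z.re • a, z.im • a, ?_⟩
    rw [TensorProduct.tmul_smul, TensorProduct.tmul_smul, TensorProduct.smul_tmul',
      TensorProduct.smul_tmul', ← TensorProduct.add_tmul]
    congr 1
    apply Complex.ext <;> simp
  | add x y hx hy =>
    obtain ⟨a, b, rfl⟩ := hx
    obtain ⟨c, d, rfl⟩ := hy
    refine ⟨a + c, b + d, ?_⟩
    rw [TensorProduct.tmul_add, TensorProduct.tmul_add]; abel

theorem one_tmul_inj {a b : A} (h : (1 : ℂ) ⊗ₜ[ℝ] a = (1 : ℂ) ⊗ₜ[ℝ] b) : a = b :=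
  Algebra.TensorProduct.includeRight_injective (R := ℝ) (A := ℂ) (B := A)
    (algebraMap ℝ ℂ).injective h

theorem tau_fixed (x : ℂ ⊗[ℝ] A) (h : tau A x = x) : ∃ a : A, x = (1 : ℂ) ⊗ₜ a := by
  obtain ⟨a, b, rfl⟩ := exists_decomp x
  refine ⟨a, ?_⟩
  have h1 : Complex.I ⊗ₜ[ℝ] b + Complex.I ⊗ₜ[ℝ] b = 0 := by
    simp only [map_add, tau_tmul, map_one, Complex.conj_I, TensorProduct.neg_tmul] at h
    have := add_left_cancel h
    nth_rewrite 1 [← this]; simp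
  have h2 : (1 : ℂ) ⊗ₜ[ℝ] b = 0 := by
    have := congrArg (fun x => (-(1/2) * Complex.I : ℂ) • x) h1
    simp only [TensorProduct.smul_tmul', ← TensorProduct.add_tmul, smul_zero,
      smul_eq_mul] at this
    convert this using 2
    ring_nf; simp
  have h3 : b = 0 := one_tmul_inj (by simpa using h2)
  simp [h3]

/-- descent -/
theorem descent (Φ : (ℂ ⊗[ℝ] A) ≃ₐ[ℂ] (ℂ ⊗[ℝ] B)) (h : ∀ x, Φ (tau A x) = tau B (Φ x)) :
    Nonempty (A ≃ₐ[ℝ] B) := by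
  have key : ∀ a : A, ∃ b : B, Φ (1 ⊗ₜ a) = 1 ⊗ₜ b := fun a =>
    tau_fixed _ (by rw [← h]; simp [tau_tmul])
  choose f hf using key
  have fmul : ∀ x y, f (x * y) = f x * f y := fun x y => one_tmul_inj (by
    rw [← hf]
    have : (1 : ℂ) ⊗ₜ[ℝ] (x * y) = (1 ⊗ₜ x) * (1 ⊗ₜ y) := by simp
    rw [this, map_mul, hf, hf]; simp)
  have fadd : ∀ x y, f (x + y) = f x + f y := fun x y => one_tmul_inj (by
    rw [← hf, TensorProduct.tmul_add, map_add, hf, hf, TensorProduct.tmul_add])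
  have falg : ∀ r : ℝ, f (algebraMap ℝ A r) = algebraMap ℝ B r := fun r => one_tmul_inj (by
    have e : ∀ (C : Type) [CommRing C] [Algebra ℝ C], (1 : ℂ) ⊗ₜ[ℝ] (algebraMap ℝ C r) =
        algebraMap ℂ (ℂ ⊗[ℝ] C) (r : ℂ) := by
      intro C _ _
      rw [Algebra.algebraMap_eq_smul_one, TensorProduct.tmul_smul, TensorProduct.smul_tmul']
      simp [Algebra.TensorProduct.algebraMap_apply]
    rw [← hf, e, e]; exact Φ.commutes _)
  let F : A →ₐ[ℝ] B := AlgHom.mk' { toFun := f, map_one' := by simpa using falg 1, map_mul' := fmul, map_zero' := by simpa using falg 0, map_add' := fadd } (by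
      intro r x
      rw [Algebra.smul_def, Algebra.smul_def]
      exact (fmul _ _).trans (by rw [falg]; rfl))
  refine ⟨AlgEquiv.ofBijective F ⟨fun x y hxy => ?_, fun b => ?_⟩⟩
  · have hxy : f x = f y := hxy
    apply one_tmul_inj
    apply Φ.injective
    rw [hf, hf, hxy]
  · obtain ⟨a, ha⟩ := tau_fixed (Φ.symm (1 ⊗ₜ b)) (by
      apply Φ.injective
      rw [h]; simp [tau_tmul])
    refine ⟨a, one_tmul_inj ?_⟩
    change _ ⊗ₜ f a = _
    rw [← hf, ← ha]; simp

theorem tau_congr (e : A ≃ₐ[ℝ] B) (x : ℂ ⊗[ℝ] A) :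
    Algebra.TensorProduct.congr (AlgEquiv.refl : ℂ ≃ₐ[ℂ] ℂ) e (tau A x) =
    tau B (Algebra.TensorProduct.congr (AlgEquiv.refl : ℂ ≃ₐ[ℂ] ℂ) e x) := by
  induction x with
  | zero => simp
  | tmul z a => simp [tau_tmul]
  | add x y hx hy => simp only [map_add, hx, hy]

/-- conjugated real structure -/
noncomputable def sig (φ : (ℂ ⊗[ℝ] A) ≃ₐ[ℂ] TL) : TL →+* TL :=
  ((φ : (ℂ ⊗[ℝ] A) →+* TL).comp (tau A : (ℂ ⊗[ℝ] A) →+* (ℂ ⊗[ℝ] A))).comp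
    (φ.symm : TL →+* (ℂ ⊗[ℝ] A))

theorem sig_apply (φ : (ℂ ⊗[ℝ] A) ≃ₐ[ℂ] TL) (x) : sig φ x = φ (tau A (φ.symm x)) := rfl

theorem sig_sig (φ : (ℂ ⊗[ℝ] A) ≃ₐ[ℂ] TL) (x) : sig φ (sig φ x) = x := by
  simp [sig_apply, tau_tau]

theorem sig_const (φ : (ℂ ⊗[ℝ] A) ≃ₐ[ℂ] TL) (z) :
    sig φ (mo 0 z) = mo 0 (starRingEnd ℂ z) := by
  rw [sig_apply, mo_zero, AlgEquiv.commutes, tau_algebraMap, AlgEquiv.commutes]; rfl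

/-- `A` has a real structure of the given type. -/
def HasT (A : Type) [CommRing A] [Algebra ℝ A] (p : ℤ × ℤ) (α : ℂ) (q : ℤ × ℤ) (β : ℂ) : Prop :=
  ∃ φ : (ℂ ⊗[ℝ] A) ≃ₐ[ℂ] TL, sig φ (mo (1, 0) 1) = mo p α ∧ sig φ (mo (0, 1) 1) = mo q β

theorem iso_of_hasT {p q α β} (hA : HasT A p α q β) (hB : HasT B p α q β) :
    Nonempty (A ≃ₐ[ℝ] B) := by
  obtain ⟨φ, h1, h2⟩ := hA
  obtain ⟨ψ, k1, k2⟩ := hB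
  have e : sig φ = sig ψ := tl_ringHom_ext _ _ (fun z => by rw [sig_const, sig_const])
    (h1.trans k1.symm) (h2.trans k2.symm)
  refine descent (φ.trans ψ.symm) fun x => ?_
  have := DFunLike.congr_fun e (φ x)
  simp only [sig_apply, AlgEquiv.symm_apply_apply] at this
  simp [this]

theorem mo_decomp (m z) : mo m z = mo 0 z * mo m 1 := by rw [mo_mul]; simp

theorem sig_ne (φ : (ℂ ⊗[ℝ] A) ≃ₐ[ℂ] TL) {m p α} (h : sig φ (mo m 1) = mo p α) : α ≠ 0 := by
  rintro rfl
  have := (mo_isUnit m one_ne_zero).map (sig φ)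
  rw [h] at this
  simp at this

theorem sig_mo (φ : (ℂ ⊗[ℝ] A) ≃ₐ[ℂ] TL) {p q α β}
    (h1 : sig φ (mo (1, 0) 1) = mo p α) (h2 : sig φ (mo (0, 1) 1) = mo q β) (m z) :
    sig φ (mo m z) = mo (m.1 • p + m.2 • q) (starRingEnd ℂ z * (α ^ m.1 * β ^ m.2)) := by
  have hα := sig_ne φ h1
  have hβ := sig_ne φ h2
  have : (sig φ : TL →* TL).comp (AddMonoidAlgebra.of ℂ (ℤ × ℤ)) =
     (tlLift (moU p α hα) (moU q β hβ) : TL →* TL).comp (AddMonoidAlgebra.of ℂ (ℤ × ℤ)) :=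
    mhom_ext _ _ (h1.trans (tlLift_1 (moU p α hα) (moU q β hβ)).symm)
      (h2.trans (tlLift_2 (moU p α hα) (moU q β hβ)).symm)
  have := DFunLike.congr_fun this (Multiplicative.ofAdd m)
  change sig φ (mo m 1) = tlLift (moU p α hα) (moU q β hβ) (mo m 1) at this
  rw [mo_decomp, map_mul, sig_const, this, tlLift_moU, mo_mul]
  simp

theorem HasT.rel {p q α β} (hA : HasT A p α q β) : α ≠ 0 ∧ β ≠ 0 ∧
    p.1 • p + p.2 • q = (1, 0) ∧ q.1 • p + q.2 • q = (0, 1) ∧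
    starRingEnd ℂ α * (α ^ p.1 * β ^ p.2) = 1 ∧ starRingEnd ℂ β * (α ^ q.1 * β ^ q.2) = 1 := by
  obtain ⟨φ, h1, h2⟩ := hA
  have e1 := sig_sig φ (mo (1, 0) 1)
  have e2 := sig_sig φ (mo (0, 1) 1)
  rw [h1, sig_mo φ h1 h2] at e1
  rw [h2, sig_mo φ h1 h2] at e2
  obtain ⟨a, b⟩ := mo_inj one_ne_zero e1.symm
  obtain ⟨c, d⟩ := mo_inj one_ne_zero e2.symm
  exact ⟨sig_ne φ h1, sig_ne φ h2, a.symm, c.symm, b.symm, d.symm⟩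

theorem exists_hasT (hA : IsRealFormTorus A) : ∃ p α q β, HasT A p α q β := by
  obtain ⟨φ⟩ := hA
  obtain ⟨p, α, -, h1⟩ := unit_mo _ ((mo_isUnit (1, 0) one_ne_zero).map (sig φ))
  obtain ⟨q, β, -, h2⟩ := unit_mo _ ((mo_isUnit (0, 1) one_ne_zero).map (sig φ))
  exact ⟨p, α, q, β, φ, h1, h2⟩

theorem HasT.realForm {p q α β} (hA : HasT A p α q β) : IsRealFormTorus A := by
  obtain ⟨φ, -⟩ := hA
  exact ⟨φ⟩

theorem HasT.change {p q α β} (hA : HasT A p α q β) (v w : ℤ × ℤ) (s t : ℂ) (hs : s ≠ 0)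
    (ht : t ≠ 0) (hdet : (v.1 * w.2 - v.2 * w.1) ^ 2 = 1) (p' q' : ℤ × ℤ) (α' β' : ℂ)
    (h1 : v.1 • p + v.2 • q = p'.1 • v + p'.2 • w)
    (h2 : w.1 • p + w.2 • q = q'.1 • v + q'.2 • w)
    (h3 : starRingEnd ℂ s * (α ^ v.1 * β ^ v.2) = α' * (s ^ p'.1 * t ^ p'.2))
    (h4 : starRingEnd ℂ t * (α ^ w.1 * β ^ w.2) = β' * (s ^ q'.1 * t ^ q'.2)) :
    HasT A p' α' q' β' := by
  obtain ⟨φ, k1, k2⟩ := hA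
  obtain ⟨v1, v2⟩ := v
  obtain ⟨w1, w2⟩ := w
  set d := v1 * w2 - v2 * w1 with hd
  have hdd : d * d = 1 := by rw [← hdet]; ring
  let f : TL →ₐ[ℂ] TL := tlLift (moU (v1, v2) s hs) (moU (w1, w2) t ht)
  let s' : ℂ := (s ^ (d * w2) * t ^ (- d * v2))⁻¹
  let t' : ℂ := (s ^ (- d * w1) * t ^ (d * v1))⁻¹
  have hs' : s' ≠ 0 := inv_ne_zero (mul_ne_zero (zpow_ne_zero _ hs) (zpow_ne_zero _ ht))
  have ht' : t' ≠ 0 := inv_ne_zero (mul_ne_zero (zpow_ne_zero _ hs) (zpow_ne_zero _ ht))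
  let g : TL →ₐ[ℂ] TL := tlLift (moU (d * w2, - d * v2) s' hs') (moU (- d * w1, d * v1) t' ht')
  have fg : f.comp g = AlgHom.id ℂ TL := by
    apply tl_algHom_ext
    · rw [AlgHom.comp_apply, tlLift_1]
      change f (mo _ _) = mo _ _
      rw [tlLift_moU]
      congr 1
      · ext
        · simp; linear_combination hdd
        · simp; ring
      · exact inv_mul_cancel₀ (mul_ne_zero (zpow_ne_zero _ hs) (zpow_ne_zero _ ht))
    · rw [AlgHom.comp_apply, tlLift_2]
      change f (mo _ _) = mo _ _
      rw [tlLift_moU]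
      congr 1
      · ext
        · simp; ring
        · simp; linear_combination hdd
      · exact inv_mul_cancel₀ (mul_ne_zero (zpow_ne_zero _ hs) (zpow_ne_zero _ ht))
  have es : ∀ a b : ℤ, s' ^ a * t' ^ b = s ^ (-(d * w2) * a + d * w1 * b) *
      t ^ (d * v2 * a + -(d * v1) * b) := by
    intro a b
    simp only [s', t', mul_inv, ← zpow_neg, mul_zpow, ← zpow_mul]
    rw [zpow_add₀ hs, zpow_add₀ ht]
    ring_nf
  have gf : g.comp f = AlgHom.id ℂ TL := by
    apply tl_algHom_ext
    · rw [AlgHom.comp_apply, tlLift_1]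
      change g (mo _ _) = mo _ _
      rw [tlLift_moU, es]
      congr 1
      · ext
        · simp; linear_combination hdd
        · simp; ring
      · have a1 : (-(d * w2) * v1 + d * w1 * v2) = -1 := by linear_combination -hdd
        have a2 : (d * v2 * v1 + -(d * v1) * v2) = 0 := by ring
        simp only [a1, a2]; simp [hs]
    · rw [AlgHom.comp_apply, tlLift_2]
      change g (mo _ _) = mo _ _
      rw [tlLift_moU, es]
      congr 1
      · ext
        · simp; ring
        · simp; linear_combination hdd
      · have a1 : (-(d * w2) * w1 + d * w1 * w2) = 0 := by ring
        have a2 : (d * v2 * w1 + -(d * v1) * w2) = -1 := by linear_combination -hdd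
        simp only [a1, a2]; simp [ht]
  let ψ : TL ≃ₐ[ℂ] TL := AlgEquiv.ofAlgHom f g fg gf
  refine ⟨φ.trans ψ.symm, ?_, ?_⟩
  · have e : f (mo (1, 0) 1) = mo (v1, v2) s := tlLift_1 _ _
    have e' := sig_mo φ k1 k2 (v1, v2) s
    rw [h1, h3] at e'
    have : mo (p'.1 • (v1, v2) + p'.2 • (w1, w2)) (α' * (s ^ p'.1 * t ^ p'.2)) = f (mo p' α') :=
      (tlLift_moU ..).symm
    rw [this, ← e] at e'
    apply ψ.injective
    simp only [sig_apply, AlgEquiv.trans_apply, AlgEquiv.apply_symm_apply, AlgEquiv.symm_trans_apply,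
      AlgEquiv.symm_symm]
    exact e'
  · have e : f (mo (0, 1) 1) = mo (w1, w2) t := tlLift_2 _ _
    have e' := sig_mo φ k1 k2 (w1, w2) t
    rw [h2, h4] at e'
    have : mo (q'.1 • (v1, v2) + q'.2 • (w1, w2)) (β' * (s ^ q'.1 * t ^ q'.2)) = f (mo q' β') :=
      (tlLift_moU ..).symm
    rw [this, ← e] at e'
    apply ψ.injective
    simp only [sig_apply, AlgEquiv.trans_apply, AlgEquiv.apply_symm_apply, AlgEquiv.symm_trans_apply,
      AlgEquiv.symm_symm]
    exact e'

theorem conj_of_iso {p q α β p' q' α' β'} (hA : HasT A p α q β) (hB : HasT B p' α' q' β')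
    (e : A ≃ₐ[ℝ] B) : ∃ P : ℤ × ℤ → ℤ × ℤ, Function.Surjective P ∧
      (∀ m n, P (m + n) = P m + P n) ∧
      ∀ m : ℤ × ℤ, P (m.1 • p + m.2 • q) = (P m).1 • p' + (P m).2 • q' := by
  obtain ⟨φ, h1, h2⟩ := hA
  obtain ⟨φ', h1', h2'⟩ := hB
  let E := Algebra.TensorProduct.congr (AlgEquiv.refl : ℂ ≃ₐ[ℂ] ℂ) e
  let ψ : TL ≃ₐ[ℂ] TL := (φ.symm.trans E).trans φ'
  have hψ : ∀ x, ψ (sig φ x) = sig φ' (ψ x) := by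
    intro x
    simp only [sig_apply, ψ, AlgEquiv.trans_apply, AlgEquiv.symm_apply_apply, E, tau_congr]
  have key : ∀ m, ∃ n z, z ≠ 0 ∧ ψ (mo m 1) = mo n z := fun m =>
    unit_mo _ ((mo_isUnit m one_ne_zero).map ψ)
  choose P c hc hP using key
  have hP' : ∀ m z, ψ (mo m z) = mo (P m) (z * c m) := by
    intro m z
    rw [← smul_mo, ← hP, ← map_smul, smul_mo, mul_one]
  refine ⟨P, ?_, ?_, ?_⟩
  · intro m
    obtain ⟨n, z, hz, h⟩ := unit_mo _ ((mo_isUnit m one_ne_zero).map ψ.symm)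
    refine ⟨n, ?_⟩
    have := congrArg ψ h
    rw [AlgEquiv.apply_symm_apply, hP'] at this
    exact (mo_inj one_ne_zero this).1.symm
  · intro m n
    have := hP (m + n)
    have e : mo (m + n) 1 = mo m 1 * mo n 1 := by rw [mo_mul, one_mul]
    rw [e, map_mul, hP, hP, mo_mul] at this
    exact (mo_inj (mul_ne_zero (hc _) (hc _)) this).1.symm
  · intro m
    have := hψ (mo m 1)
    rw [sig_mo φ h1 h2, hP', hP, sig_mo φ' h1' h2'] at this
    refine (mo_inj ?_ this).1
    have := sig_ne φ h1
    have := sig_ne φ h2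
    refine mul_ne_zero ?_ (hc _)
    simp [zpow_ne_zero, *]

end


section
variable {A B : Type} [CommRing A] [Algebra ℝ A] [CommRing B] [Algebra ℝ B]

theorem HasT.change1 {p q α β} (hA : HasT A p α q β) (v w : ℤ × ℤ)
    (hdet : (v.1 * w.2 - v.2 * w.1) ^ 2 = 1) (p' q' : ℤ × ℤ)
    (h1 : v.1 • p + v.2 • q = p'.1 • v + p'.2 • w)
    (h2 : w.1 • p + w.2 • q = q'.1 • v + q'.2 • w) :
    HasT A p' (α ^ v.1 * β ^ v.2) q' (α ^ w.1 * β ^ w.2) :=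
  hA.change v w 1 1 one_ne_zero one_ne_zero hdet p' q' _ _ h1 h2 (by simp) (by simp)

theorem HasT.scale {p q α β} (hA : HasT A p α q β) (s t α' β' : ℂ) (hs : s ≠ 0) (ht : t ≠ 0)
    (h3 : starRingEnd ℂ s * α = α' * (s ^ p.1 * t ^ p.2))
    (h4 : starRingEnd ℂ t * β = β' * (s ^ q.1 * t ^ q.2)) : HasT A p α' q β' :=
  hA.change (1, 0) (0, 1) s t hs ht (by simp) p q α' β' (by ext <;> simp) (by ext <;> simp)
    (by simpa using h3) (by simpa using h4)

theorem lattice_trace_zero (a b c : ℤ) (h : a * a + b * c = 1) :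
    ∃ v1 v2 w1 w2 k : ℤ, v1 * w2 - v2 * w1 = 1 ∧ v1 * a + v2 * c = v1 ∧ v1 * b + v2 * (-a) = v2 ∧
      w1 * a + w2 * c = -w1 + k * v1 ∧ w1 * b + w2 * (-a) = - w2 + k * v2 ∧ (k = 0 ∨ k = 1) := by
  obtain ⟨x, y, h0, h1, h2⟩ : ∃ x y : ℤ, (x ≠ 0 ∨ y ≠ 0) ∧ x * a + y * c = x ∧
      x * b + y * (-a) = y := by
    by_cases ha : a = 1
    · exact ⟨1 + a, b, by left; omega, by linear_combination h, by ring⟩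
    · exact ⟨c, 1 - a, by right; omega, by ring, by linear_combination h⟩
  have hg : 0 < Int.gcd x y := Int.gcd_pos_iff.2 h0
  have hg' : (Int.gcd x y : ℤ) ≠ 0 := by exact_mod_cast hg.ne'
  obtain ⟨v1, hv1⟩ := Int.gcd_dvd_left x y
  obtain ⟨v2, hv2⟩ := Int.gcd_dvd_right x y
  have hb := Int.gcd_eq_gcd_ab x y
  set g : ℤ := (Int.gcd x y : ℤ) with hgdef
  have e1 : v1 * a + v2 * c = v1 := mul_left_cancel₀ hg' (by
    linear_combination h1 + (1 - a) * hv1 - c * hv2)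
  have e2 : v1 * b + v2 * (-a) = v2 := mul_left_cancel₀ hg' (by
    linear_combination h2 + (1 + a) * hv2 - b * hv1)
  obtain ⟨w1, w2, hw⟩ : ∃ w1 w2 : ℤ, v1 * w2 - v2 * w1 = 1 :=
    ⟨-Int.gcdB x y, Int.gcdA x y, mul_left_cancel₀ hg' (by
      linear_combination -hb - (Int.gcdA x y) * hv1 - (Int.gcdB x y) * hv2)⟩
  -- Mw = k v - w
  obtain ⟨k, hk⟩ : ∃ k : ℤ, k = (w1 * a + w2 * c) * w2 - (w1 * b + w2 * (-a)) * w1 := ⟨_, rfl⟩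
  have hy : v1 * (w1 * b + w2 * (-a)) - v2 * (w1 * a + w2 * c) = -1 := by
    linear_combination (-1) * hw - w2 * e1 + w1 * e2
  have f1 : w1 * a + w2 * c = -w1 + k * v1 := by
    linear_combination -(w1 * a + w2 * c) * hw - v1 * hk + w1 * hy
  have f2 : w1 * b + w2 * (-a) = - w2 + k * v2 := by
    linear_combination -(w1 * b + w2 * (-a)) * hw - v2 * hk + w2 * hy
  obtain ⟨j, hj⟩ : ∃ j, k = 2 * j + 0 ∨ k = 2 * j + 1 := by
    refine ⟨k / 2, ?_⟩; omega
  refine ⟨v1, v2, w1 - j * v1, w2 - j * v2, k - 2 * j, ?_, e1, e2, ?_, ?_, ?_⟩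
  · linear_combination hw
  · linear_combination f1 - j * e1
  · linear_combination f2 - j * e2
  · omega

theorem HasT.normalM {p q α β} (hA : HasT A p α q β) : ∃ α' β',
    HasT A (1, 0) α' (0, 1) β' ∨ HasT A (1, 0) α' (0, -1) β' ∨ HasT A (-1, 0) α' (0, -1) β' ∨
    HasT A (0, 1) α' (1, 0) β' := by
  obtain ⟨-, -, r1, r2, -, -⟩ := hA.rel
  obtain ⟨a, b⟩ := p
  obtain ⟨c, d⟩ := q
  simp only [Prod.smul_mk, smul_eq_mul, Prod.mk_add_mk, Prod.mk.injEq] at r1 r2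
  obtain ⟨r11, r12⟩ := r1
  obtain ⟨r21, r22⟩ := r2
  by_cases htr : a + d = 0
  · obtain rfl : d = -a := by omega
    obtain ⟨v1, v2, w1, w2, k, h1, h2, h3, h4, h5, rfl | rfl⟩ := lattice_trace_zero a b c r11
    · refine ⟨_, _, Or.inr (Or.inl (hA.change1 (v1, v2) (w1, w2) ?_ _ _ ?_ ?_))⟩
      · simp [h1]
      · ext <;> simp <;> linarith
      · ext <;> simp <;> linarith
    · refine ⟨_, _, Or.inr (Or.inr (Or.inr (hA.change1 (w1, w2) (v1 - w1, v2 - w2) ?_ _ _ ?_ ?_)))⟩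
      · have : w1 * (v2 - w2) - w2 * (v1 - w1) = -1 := by linear_combination -h1
        simp [this]
      · ext <;> simp <;> linarith
      · ext <;> simp <;> linarith
  · have hb : b = 0 := by
      have : b * (a + d) = 0 := by linear_combination r12
      simpa [htr] using this
    have hc : c = 0 := by
      have : c * (a + d) = 0 := by linear_combination r21
      simpa [htr] using this
    subst hb hc
    have ha : a = 1 ∨ a = -1 := mul_self_eq_one_iff.1 (by linarith)
    have hd : d = 1 ∨ d = -1 := mul_self_eq_one_iff.1 (by linarith)
    rcases ha with rfl | rfl <;> rcases hd with rfl | rfl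
    · exact ⟨_, _, Or.inl hA⟩
    · omega
    · omega
    · exact ⟨_, _, Or.inr (Or.inr (Or.inl hA))⟩

theorem hilbert90 (α : ℂ) (h : starRingEnd ℂ α * α = 1) :
    ∃ s : ℂ, s ≠ 0 ∧ starRingEnd ℂ s * α = s := by
  by_cases hα : α = -1
  · exact ⟨Complex.I, Complex.I_ne_zero, by simp [hα]⟩
  · refine ⟨1 + α, fun h => hα (by linear_combination h), ?_⟩
    simp only [map_add, map_one]; linear_combination h

theorem realnorm (α : ℂ) (hα : α ≠ 0) (h : starRingEnd ℂ α * α⁻¹ = 1) :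
    ∃ s ε : ℂ, s ≠ 0 ∧ (ε = 1 ∨ ε = -1) ∧ starRingEnd ℂ s * α = ε * s⁻¹ := by
  have h' : starRingEnd ℂ α = α := by field_simp at h; exact h
  obtain ⟨r, rfl⟩ := Complex.conj_eq_iff_real.1 h'
  have hr : r ≠ 0 := by simpa using hα
  have hp : 0 < |r| := abs_pos.2 hr
  have hsq : Real.sqrt |r| ≠ 0 := (Real.sqrt_pos.2 hp).ne'
  have hss : Real.sqrt |r| * Real.sqrt |r| = |r| := Real.mul_self_sqrt hp.le
  rcases lt_or_gt_of_ne hr with hn | hn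
  · refine ⟨((Real.sqrt |r|)⁻¹ : ℝ), -1, by simpa using hsq, Or.inr rfl, ?_⟩
    rw [Complex.conj_ofReal]
    rw [abs_of_neg hn] at *
    norm_cast
    push_cast
    field_simp
    nlinarith
  · refine ⟨((Real.sqrt |r|)⁻¹ : ℝ), 1, by simpa using hsq, Or.inl rfl, ?_⟩
    rw [Complex.conj_ofReal]
    rw [abs_of_pos hn] at *
    norm_cast
    push_cast
    field_simp
    nlinarith

theorem HasT.classify {p q α β} (hA : HasT A p α q β) :
    HasT A (1, 0) 1 (0, 1) 1 ∨ HasT A (1, 0) 1 (0, -1) 1 ∨ HasT A (1, 0) 1 (0, -1) (-1) ∨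
    HasT A (-1, 0) 1 (0, -1) 1 ∨ HasT A (-1, 0) (-1) (0, -1) (-1) ∨
    HasT A (0, 1) 1 (1, 0) 1 := by
  obtain ⟨α, β, h | h | h | h⟩ := hA.normalM
  · obtain ⟨ha, hb, -, -, h1, h2⟩ := h.rel
    simp only [zpow_one, zpow_zero, mul_one, one_mul] at h1 h2
    obtain ⟨s, hs, h1⟩ := hilbert90 α h1
    obtain ⟨t, ht, h2⟩ := hilbert90 β h2
    exact Or.inl (h.scale s t 1 1 hs ht (by simpa using h1) (by simpa using h2))
  · obtain ⟨ha, hb, -, -, h1, h2⟩ := h.rel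
    simp only [zpow_one, zpow_zero, mul_one, one_mul, zpow_neg] at h1 h2
    obtain ⟨s, hs, h1⟩ := hilbert90 α h1
    obtain ⟨t, ε, ht, hε, h2⟩ := realnorm β hb h2
    have := h.scale s t 1 ε hs ht (by simpa using h1) (by simpa using h2)
    rcases hε with rfl | rfl
    · exact Or.inr (Or.inl this)
    · exact Or.inr (Or.inr (Or.inl this))
  · obtain ⟨ha, hb, -, -, h1, h2⟩ := h.rel
    simp only [zpow_one, zpow_zero, mul_one, one_mul, zpow_neg] at h1 h2
    obtain ⟨s, δ, hs, hδ, h1⟩ := realnorm α ha h1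
    obtain ⟨t, ε, ht, hε, h2⟩ := realnorm β hb h2
    have := h.scale s t δ ε hs ht (by simpa using h1) (by simpa using h2)
    rcases hδ with rfl | rfl <;> rcases hε with rfl | rfl
    · exact Or.inr (Or.inr (Or.inr (Or.inl this)))
    · have := this.change1 (1, 1) (0, 1) (by simp) (-1, 0) (0, -1) (by simp) (by simp)
      simp only [zpow_one, zpow_zero, mul_one, one_mul] at this
      exact Or.inr (Or.inr (Or.inr (Or.inr (Or.inl this))))
    · have := this.change1 (1, 0) (1, 1) (by simp) (-1, 0) (0, -1) (by simp) (by simp)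
      simp only [zpow_one, zpow_zero, mul_one, one_mul] at this
      exact Or.inr (Or.inr (Or.inr (Or.inr (Or.inl this))))
    · exact Or.inr (Or.inr (Or.inr (Or.inr (Or.inl this))))
  · obtain ⟨ha, hb, -, -, h1, h2⟩ := h.rel
    simp only [zpow_one, zpow_zero, mul_one, one_mul] at h1 h2
    exact Or.inr (Or.inr (Or.inr (Or.inr (Or.inr (h.scale 1 α 1 1 one_ne_zero ha (by simp)
      (by simpa using h1))))))

end


/-- one-dimensional torus -/
def Has1 (Γ : Type) [CommRing Γ] [Algebra ℝ Γ] (u : (ℂ ⊗[ℝ] Γ)ˣ) : Prop :=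
  (∀ (R : Type) [CommRing R] [Algebra ℂ R] [Algebra ℝ R] [IsScalarTower ℝ ℂ R] (r : Rˣ),
    ∃ f : (ℂ ⊗[ℝ] Γ) →ₐ[ℂ] R, f u = r) ∧
  (∀ (R : Type) [CommRing R] [Algebra ℂ R] [Algebra ℝ R] [IsScalarTower ℝ ℂ R]
    (f g : (ℂ ⊗[ℝ] Γ) →ₐ[ℂ] R), f u = g u → f = g)

section
variable {A B : Type} [CommRing A] [Algebra ℝ A] [CommRing B] [Algebra ℝ B]

theorem smul_tens (z : ℂ) (w : ℂ ⊗[ℝ] A) : z • w = algebraMap ℂ (ℂ ⊗[ℝ] A) z * w := by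
  induction w with
  | zero => rw [smul_zero, mul_zero]
  | tmul a b => simp [Algebra.TensorProduct.algebraMap_apply, TensorProduct.smul_tmul']
  | add x y hx hy => rw [smul_add, mul_add, hx, hy]

theorem cx_ext {R : Type} [CommRing R] [Algebra ℂ R]
    (f g : (ℂ ⊗[ℝ] A) →ₐ[ℂ] R) (h : ∀ a, f (1 ⊗ₜ a) = g (1 ⊗ₜ a)) : f = g := by
  apply AlgHom.ext
  intro x
  induction x with
  | zero => simp
  | tmul z a =>
    have : z ⊗ₜ[ℝ] a = z • ((1 : ℂ) ⊗ₜ[ℝ] a) := by simp [TensorProduct.smul_tmul']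
    rw [this, map_smul, map_smul, h]
  | add x y hx hy => rw [map_add, map_add, hx, hy]

/-- extension of scalars -/
noncomputable def cxLift {R : Type} [CommRing R] [Algebra ℂ R] [Algebra ℝ R] [IsScalarTower ℝ ℂ R]
    (f : A →ₐ[ℝ] R) : (ℂ ⊗[ℝ] A) →ₐ[ℂ] R :=
  Algebra.TensorProduct.lift (Algebra.ofId ℂ R) f (fun _ _ => mul_comm _ _)

theorem cxLift_tmul {R : Type} [CommRing R] [Algebra ℂ R] [Algebra ℝ R] [IsScalarTower ℝ ℂ R]
    (f : A →ₐ[ℝ] R) (z : ℂ) (a : A) : cxLift f (z ⊗ₜ a) = algebraMap ℂ R z * f a := by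
  exact Algebra.TensorProduct.lift_tmul ..

/-- functoriality -/
noncomputable def cxMap (f : A →ₐ[ℝ] B) : (ℂ ⊗[ℝ] A) →ₐ[ℂ] (ℂ ⊗[ℝ] B) :=
  Algebra.TensorProduct.map (AlgHom.id ℂ ℂ) f

theorem cxMap_tmul (f : A →ₐ[ℝ] B) (z : ℂ) (a : A) : cxMap f (z ⊗ₜ a) = z ⊗ₜ f a := rfl

theorem tau_cxMap (f : A →ₐ[ℝ] B) (x) : tau B (cxMap f x) = cxMap f (tau A x) := by
  induction x with
  | zero => simp
  | tmul z a => simp [tau_tmul, cxMap_tmul]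
  | add x y hx hy => simp only [map_add, hx, hy]

theorem map_smul_zpow {R S : Type} [CommRing R] [CommRing S] [Algebra ℂ R] [Algebra ℂ S]
    (f : R →ₐ[ℂ] S) (u : Rˣ) (v : Sˣ) (h : f u = v) (a : ℤ) (ε : ℂ) :
    f (ε • ((u ^ a : Rˣ) : R)) = ε • ((v ^ a : Sˣ) : S) := by
  have : Units.map (f : R →* S) u = v := Units.ext h
  rw [map_smul, ← this, ← map_zpow]; rfl

theorem hasT_prod {u : (ℂ ⊗[ℝ] A)ˣ} {v : (ℂ ⊗[ℝ] B)ˣ} (hu : Has1 A u) (hv : Has1 B v)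
    (a b : ℤ) (ε δ : ℂ) (ha : tau A u = ε • ((u ^ a : (ℂ ⊗[ℝ] A)ˣ) : ℂ ⊗[ℝ] A))
    (hb : tau B v = δ • ((v ^ b : (ℂ ⊗[ℝ] B)ˣ) : ℂ ⊗[ℝ] B)) :
    HasT (A ⊗[ℝ] B) (a, 0) ε (0, b) δ := by
  let il : (ℂ ⊗[ℝ] A) →ₐ[ℂ] (ℂ ⊗[ℝ] (A ⊗[ℝ] B)) := cxMap Algebra.TensorProduct.includeLeft
  let ir : (ℂ ⊗[ℝ] B) →ₐ[ℂ] (ℂ ⊗[ℝ] (A ⊗[ℝ] B)) := cxMap Algebra.TensorProduct.includeRight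
  obtain ⟨f1, hf1⟩ := hu.1 TL (moU (1, 0) 1 one_ne_zero)
  obtain ⟨f2, hf2⟩ := hv.1 TL (moU (0, 1) 1 one_ne_zero)
  let F : (ℂ ⊗[ℝ] (A ⊗[ℝ] B)) →ₐ[ℂ] TL := cxLift (Algebra.TensorProduct.productMap
    ((f1.restrictScalars ℝ).comp Algebra.TensorProduct.includeRight)
    ((f2.restrictScalars ℝ).comp Algebra.TensorProduct.includeRight))
  have Fl : F.comp il = f1 := cx_ext _ _ fun x => by
    simp only [AlgHom.comp_apply, F, il, cxMap_tmul, cxLift_tmul, map_one, one_mul, mul_one,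
      Algebra.TensorProduct.includeLeft_apply, Algebra.TensorProduct.includeRight_apply,
      Algebra.TensorProduct.productMap_apply_tmul, AlgHom.restrictScalars_apply]
  have Fr : F.comp ir = f2 := cx_ext _ _ fun x => by
    simp only [AlgHom.comp_apply, F, ir, cxMap_tmul, cxLift_tmul, map_one, one_mul, mul_one,
      Algebra.TensorProduct.includeLeft_apply, Algebra.TensorProduct.includeRight_apply,
      Algebra.TensorProduct.productMap_apply_tmul, AlgHom.restrictScalars_apply]
  let g : TL →ₐ[ℂ] (ℂ ⊗[ℝ] (A ⊗[ℝ] B)) := tlLift (Units.map (il : _ →* _) u)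
    (Units.map (ir : _ →* _) v)
  have g1 : g (mo (1, 0) 1) = il u := tlLift_1 _ _
  have g2 : g (mo (0, 1) 1) = ir v := tlLift_2 _ _
  have Fg : F.comp g = AlgHom.id ℂ TL := by
    apply tl_algHom_ext
    · rw [AlgHom.comp_apply, g1, ← AlgHom.comp_apply, Fl, hf1]; rfl
    · rw [AlgHom.comp_apply, g2, ← AlgHom.comp_apply, Fr, hf2]; rfl
  have k1 : g.comp f1 = il := hu.2 _ _ _ (by rw [AlgHom.comp_apply, hf1]; exact g1)
  have k2 : g.comp f2 = ir := hv.2 _ _ _ (by rw [AlgHom.comp_apply, hf2]; exact g2)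
  have l1 : (g.comp F).comp il = il := by rw [AlgHom.comp_assoc, Fl, k1]
  have l2 : (g.comp F).comp ir = ir := by rw [AlgHom.comp_assoc, Fr, k2]
  have gF : g.comp F = AlgHom.id ℂ _ := cx_ext _ _ fun x => by
    induction x with
    | zero => simp
    | tmul a b =>
      have : (1 : ℂ) ⊗ₜ[ℝ] (a ⊗ₜ[ℝ] b) = il (1 ⊗ₜ a) * ir (1 ⊗ₜ b) := by
        simp [il, ir, cxMap_tmul]
      rw [this, map_mul, map_mul, ← AlgHom.comp_apply _ il, ← AlgHom.comp_apply _ ir, l1, l2]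
      rfl
    | add x y hx hy => rw [TensorProduct.tmul_add, map_add, map_add, hx, hy]
  refine ⟨AlgEquiv.ofAlgHom F g Fg gF, ?_, ?_⟩
  · change F (tau _ (g _)) = _
    rw [g1]
    rw [tau_cxMap, ← AlgHom.comp_apply F il, Fl, ha, map_smul_zpow f1 u _ hf1, moU_zpow, smul_mo]
    simp
  · change F (tau _ (g _)) = _
    rw [g2]
    rw [tau_cxMap, ← AlgHom.comp_apply F ir, Fr, hb, map_smul_zpow f2 v _ hf2, moU_zpow, smul_mo]
    simp

theorem quot_pt (p : MvPolynomial (Fin 2) ℝ) {R : Type} [CommRing R] [Algebra ℝ R] (x y : R)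
    (h : aeval ![x, y] p = 0) : ∃ f : (MvPolynomial (Fin 2) ℝ ⧸ Ideal.span {p}) →ₐ[ℝ] R,
      f (Ideal.Quotient.mk _ (X 0)) = x ∧ f (Ideal.Quotient.mk _ (X 1)) = y := by
  refine ⟨Ideal.Quotient.liftₐ _ (aeval ![x, y]) ?_, ?_, ?_⟩
  · intro a ha
    obtain ⟨c, rfl⟩ := Ideal.mem_span_singleton.1 ha
    rw [map_mul, h, zero_mul]
  · change aeval ![x, y] (X 0) = x
    simp
  · change aeval ![x, y] (X 1) = y
    simp

theorem quot_ext (p : MvPolynomial (Fin 2) ℝ) {R : Type} [CommRing R] [Algebra ℂ R]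
    [Algebra ℝ R] [IsScalarTower ℝ ℂ R]
    (f g : (ℂ ⊗[ℝ] (MvPolynomial (Fin 2) ℝ ⧸ Ideal.span {p})) →ₐ[ℂ] R)
    (h0 : f (1 ⊗ₜ (Ideal.Quotient.mk _ (X 0))) = g (1 ⊗ₜ (Ideal.Quotient.mk _ (X 0))))
    (h1 : f (1 ⊗ₜ (Ideal.Quotient.mk _ (X 1))) = g (1 ⊗ₜ (Ideal.Quotient.mk _ (X 1)))) :
    f = g := by
  apply cx_ext
  have : (((f.restrictScalars ℝ).comp Algebra.TensorProduct.includeRight).comp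
      (Ideal.Quotient.mkₐ ℝ (Ideal.span {p}))) =
      (((g.restrictScalars ℝ).comp Algebra.TensorProduct.includeRight).comp
      (Ideal.Quotient.mkₐ ℝ (Ideal.span {p}))) := by
    apply MvPolynomial.algHom_ext
    intro i
    fin_cases i
    · exact h0
    · exact h1
  intro a
  obtain ⟨a, rfl⟩ := Ideal.Quotient.mk_surjective a
  exact DFunLike.congr_fun this a

theorem mk_rel (p q : MvPolynomial (Fin 2) ℝ) (h : p = q) :
    Ideal.Quotient.mk (Ideal.span {p}) q = 0 := by
  subst h
  exact Ideal.Quotient.eq_zero_iff_mem.2 (Ideal.mem_span_singleton_self p)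

theorem gammaS (Γ : Type) [CommRing Γ] [Algebra ℝ Γ] (x y : Γ)
    (hxy : x * y = 1)
    (hpt : ∀ (R : Type) [CommRing R] [Algebra ℝ R] (a b : R), a * b = 1 →
      ∃ f : Γ →ₐ[ℝ] R, f x = a ∧ f y = b)
    (hext : ∀ (R : Type) [CommRing R] [Algebra ℂ R] [Algebra ℝ R] [IsScalarTower ℝ ℂ R]
      (f g : (ℂ ⊗[ℝ] Γ) →ₐ[ℂ] R), f (1 ⊗ₜ x) = g (1 ⊗ₜ x) → f (1 ⊗ₜ y) = g (1 ⊗ₜ y) → f = g) :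
    ∃ u : (ℂ ⊗[ℝ] Γ)ˣ, Has1 Γ u ∧
    tau _ u = (1 : ℂ) • ((u ^ (1 : ℤ) : (ℂ ⊗[ℝ] Γ)ˣ) : ℂ ⊗[ℝ] Γ) := by
  have hxy' : ((1 : ℂ) ⊗ₜ[ℝ] x) * ((1 : ℂ) ⊗ₜ[ℝ] y) = 1 := by
    rw [Algebra.TensorProduct.tmul_mul_tmul, hxy, mul_one]; rfl
  refine ⟨⟨_, _, hxy', (mul_comm _ _).trans hxy'⟩, ⟨?_, ?_⟩, ?_⟩
  · intro R _ _ _ _ r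
    obtain ⟨f, h0, h1⟩ := hpt R (r : R) ((r⁻¹ : Rˣ) : R) (by simp)
    refine ⟨cxLift f, ?_⟩
    change cxLift f (1 ⊗ₜ x) = r
    rw [cxLift_tmul, map_one, one_mul, h0]
  · intro R _ _ _ _ f g h
    have h : f (1 ⊗ₜ x) = g (1 ⊗ₜ x) := h
    apply hext _ _ _ h
    have e1 : f (1 ⊗ₜ x) * f (1 ⊗ₜ y) = 1 := by rw [← map_mul, hxy', map_one]
    have e2 : g (1 ⊗ₜ x) * g (1 ⊗ₜ y) = 1 := by rw [← map_mul, hxy', map_one]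
    change f (1 ⊗ₜ y) = g (1 ⊗ₜ y)
    rw [h] at e1
    linear_combination g (1 ⊗ₜ y) * e1 - f (1 ⊗ₜ y) * e2
  · rw [one_smul, zpow_one]
    change tau _ (1 ⊗ₜ x) = 1 ⊗ₜ x
    simp [tau_tmul]

theorem gamma0 : ∃ u : (ℂ ⊗[ℝ] Gamma 0)ˣ, Has1 (Gamma 0) u ∧
    tau _ u = (1 : ℂ) • ((u ^ (1 : ℤ) : (ℂ ⊗[ℝ] Gamma 0)ˣ) : ℂ ⊗[ℝ] Gamma 0) := by
  have hp : conic13 0 = X 0 * X 1 - 1 := rfl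
  refine gammaS (Gamma 0) (Ideal.Quotient.mk _ (X 0)) (Ideal.Quotient.mk _ (X 1)) ?_ ?_ ?_
  · have := mk_rel _ _ hp
    rw [map_sub, map_mul, map_one, sub_eq_zero] at this
    exact this
  · intro R _ _ a b h
    exact quot_pt _ a b (by rw [hp]; simp [h])
  · intro R _ _ _ _ f g h0 h1
    exact quot_ext _ f g h0 h1

theorem gammaC (Γ : Type) [CommRing Γ] [Algebra ℝ Γ] (x y : Γ) (ε : ℝ) (hε : ε * ε = 1)
    (hxy : x ^ 2 + y ^ 2 = algebraMap ℝ Γ ε)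
    (hpt : ∀ (R : Type) [CommRing R] [Algebra ℝ R] (a b : R), a ^ 2 + b ^ 2 = algebraMap ℝ R ε →
      ∃ f : Γ →ₐ[ℝ] R, f x = a ∧ f y = b)
    (hext : ∀ (R : Type) [CommRing R] [Algebra ℂ R] [Algebra ℝ R] [IsScalarTower ℝ ℂ R]
      (f g : (ℂ ⊗[ℝ] Γ) →ₐ[ℂ] R), f (1 ⊗ₜ x) = g (1 ⊗ₜ x) → f (1 ⊗ₜ y) = g (1 ⊗ₜ y) → f = g) :
    ∃ u : (ℂ ⊗[ℝ] Γ)ˣ, Has1 Γ u ∧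
    tau _ u = (ε : ℂ) • ((u ^ (-1 : ℤ) : (ℂ ⊗[ℝ] Γ)ˣ) : ℂ ⊗[ℝ] Γ) := by
  let cx : ℂ ⊗[ℝ] Γ := 1 ⊗ₜ x
  let cy : ℂ ⊗[ℝ] Γ := 1 ⊗ₜ y
  let i : ℂ ⊗[ℝ] Γ := algebraMap ℂ _ Complex.I
  let e : ℂ ⊗[ℝ] Γ := algebraMap ℂ _ (ε : ℂ)
  have hi : i * i = -1 := by
    simp only [i, ← map_mul, Complex.I_mul_I, map_neg, map_one]
  have he : e * e = 1 := by
    simp only [e, ← map_mul]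
    rw [← Complex.ofReal_mul, hε, Complex.ofReal_one, map_one]
  have hxy2 : cx ^ 2 + cy ^ 2 = e := by
    have : (1 : ℂ) ⊗ₜ[ℝ] (x ^ 2 + y ^ 2) = cx ^ 2 + cy ^ 2 := by
      simp [cx, cy, TensorProduct.tmul_add, Algebra.TensorProduct.tmul_pow]
    rw [← this, hxy, Algebra.algebraMap_eq_smul_one, TensorProduct.tmul_smul,
      TensorProduct.smul_tmul']
    simp [e, Algebra.TensorProduct.algebraMap_apply]
  have hxy' : (cx + i * cy) * (e * (cx - i * cy)) = 1 := by
    linear_combination e * hxy2 - e * cy ^ 2 * hi + he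
  refine ⟨⟨_, _, hxy', (mul_comm _ _).trans hxy'⟩, ⟨?_, ?_⟩, ?_⟩
  · intro R _ _ _ _ r
    let s : R := ((r⁻¹ : Rˣ) : R)
    have hrs : (r : R) * s = 1 := by simp [s]
    let j : R := algebraMap ℂ R Complex.I
    let h : R := algebraMap ℂ R (1 / 2)
    let d : R := algebraMap ℂ R (ε : ℂ)
    have hj : j * j = -1 := by
      simp only [j, ← map_mul, Complex.I_mul_I, map_neg, map_one]
    have hh : h * 2 = 1 := by
      have : (2 : R) = algebraMap ℂ R 2 := (map_ofNat _ 2).symm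
      rw [this]
      simp only [h, ← map_mul]; simp
    have hd : algebraMap ℝ R ε = d := by rw [IsScalarTower.algebraMap_apply ℝ ℂ R]; rfl
    obtain ⟨f, h0, h1⟩ := hpt R (h * (r + d * s)) (-(j * h) * (r - d * s)) (by
      rw [hd]
      linear_combination h ^ 2 * (r - d * s) ^ 2 * hj + 4 * h ^ 2 * d * hrs +
        d * (2 * h + 1) * hh)
    refine ⟨cxLift f, ?_⟩
    change cxLift f (1 ⊗ₜ x + algebraMap ℂ _ Complex.I * (1 ⊗ₜ y)) = r
    rw [map_add, map_mul, AlgHom.commutes, cxLift_tmul, cxLift_tmul, map_one, one_mul, one_mul,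
      h0, h1]
    change _ + j * _ = _
    linear_combination (-h * (r - d * s)) * hj + r * hh
  · intro R _ _ _ _ f g h
    have h : f (cx + i * cy) = g (cx + i * cy) := h
    have e1 : f (cx + i * cy) * f (e * (cx - i * cy)) = 1 := by rw [← map_mul, hxy', map_one]
    have e2 : g (cx + i * cy) * g (e * (cx - i * cy)) = 1 := by rw [← map_mul, hxy', map_one]
    have h' : f (e * (cx - i * cy)) = g (e * (cx - i * cy)) := by
      rw [h] at e1
      linear_combination g (e * (cx - i * cy)) * e1 - f (e * (cx - i * cy)) * e2
    have fi : f i = algebraMap ℂ R Complex.I := f.commutes _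
    have gi : g i = algebraMap ℂ R Complex.I := g.commutes _
    have fe : f e = algebraMap ℂ R ε := f.commutes _
    have ge : g e = algebraMap ℂ R ε := g.commutes _
    simp only [map_mul, map_add, map_sub, fi, gi, fe, ge] at h h'
    have hj : algebraMap ℂ R Complex.I * algebraMap ℂ R Complex.I = -1 := by
      simp only [← map_mul, Complex.I_mul_I, map_neg, map_one]
    have hd : algebraMap ℂ R ε * algebraMap ℂ R ε = 1 := by
      simp only [← map_mul]
      rw [← Complex.ofReal_mul, hε, Complex.ofReal_one, map_one]
    have hh : algebraMap ℂ R (1 / 2) * 2 = 1 := by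
      have : (2 : R) = algebraMap ℂ R 2 := (map_ofNat _ 2).symm
      rw [this]
      simp only [← map_mul]; simp
    set j := algebraMap ℂ R Complex.I
    set d := algebraMap ℂ R ε
    set k := algebraMap ℂ R (1 / 2)
    have h'' : f cx - j * f cy = g cx - j * g cy := by
      linear_combination d * h' - (f cx - j * f cy - g cx + j * g cy) * hd
    apply hext
    · change f cx = g cx
      linear_combination k * h + k * h'' - (f cx - g cx) * hh
    · change f cy = g cy
      linear_combination (-j * k) * h + (j * k) * h'' - (f cy - g cy) * hh +
        (2 * k * (f cy - g cy)) * hj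
  · rw [zpow_neg_one]
    change tau _ (cx + i * cy) = (ε : ℂ) • (e * (cx - i * cy))
    have hsm : (ε : ℂ) • (e * (cx - i * cy)) = e * (e * (cx - i * cy)) := smul_tens _ _
    rw [hsm]
    change _ = e * (e * (cx - i * cy))
    rw [← mul_assoc, he, one_mul, map_add, map_mul, tau_algebraMap, Complex.conj_I, map_neg]
    simp only [cx, cy, tau_tmul, map_one]
    ring

theorem gammaC' (p : MvPolynomial (Fin 2) ℝ) (ε : ℝ) (hε : ε * ε = 1)
    (hp : p = X 0 ^ 2 + X 1 ^ 2 - C ε) :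
    ∃ u : (ℂ ⊗[ℝ] (MvPolynomial (Fin 2) ℝ ⧸ Ideal.span {p}))ˣ,
    Has1 (MvPolynomial (Fin 2) ℝ ⧸ Ideal.span {p}) u ∧
    tau _ u = (ε : ℂ) • ((u ^ (-1 : ℤ) : (ℂ ⊗[ℝ] (MvPolynomial (Fin 2) ℝ ⧸ Ideal.span {p}))ˣ) :
      ℂ ⊗[ℝ] (MvPolynomial (Fin 2) ℝ ⧸ Ideal.span {p})) := by
  refine gammaC _ (Ideal.Quotient.mk _ (X 0)) (Ideal.Quotient.mk _ (X 1)) ε hε ?_ ?_ ?_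
  · have := mk_rel _ _ hp
    rw [map_sub, map_add, map_pow, map_pow, sub_eq_zero] at this
    exact this
  · intro R _ _ a b h
    exact quot_pt p a b (by rw [hp]; simp [h])
  · intro R _ _ _ _ f g h0 h1
    exact quot_ext p f g h0 h1

theorem gamma1 : ∃ u : (ℂ ⊗[ℝ] Gamma 1)ˣ, Has1 (Gamma 1) u ∧
    tau _ u = (1 : ℂ) • ((u ^ (-1 : ℤ) : (ℂ ⊗[ℝ] Gamma 1)ˣ) : ℂ ⊗[ℝ] Gamma 1) := by
  have := gammaC' (conic13 1) 1 (by norm_num) (by simp [conic13])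
  simpa using this

theorem gamma2 : ∃ u : (ℂ ⊗[ℝ] Gamma 2)ˣ, Has1 (Gamma 2) u ∧
    tau _ u = (-1 : ℂ) • ((u ^ (-1 : ℤ) : (ℂ ⊗[ℝ] Gamma 2)ˣ) : ℂ ⊗[ℝ] Gamma 2) := by
  have := gammaC' (conic13 2) (-1) (by norm_num) (by simp [conic13])
  simpa using this

end


theorem plane_hasT (Γ : Type) [CommRing Γ] [Algebra ℝ Γ] (x y n : Γ)
    (hxy : (x ^ 2 + y ^ 2) * n = 1)
    (hpt : ∀ (R : Type) [CommRing R] [Algebra ℝ R] (a b c : R), (a ^ 2 + b ^ 2) * c = 1 →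
      ∃ f : Γ →ₐ[ℝ] R, f x = a ∧ f y = b)
    (hext : ∀ (R : Type) [CommRing R] [Algebra ℂ R] [Algebra ℝ R] [IsScalarTower ℝ ℂ R]
      (f g : (ℂ ⊗[ℝ] Γ) →ₐ[ℂ] R), f (1 ⊗ₜ x) = g (1 ⊗ₜ x) → f (1 ⊗ₜ y) = g (1 ⊗ₜ y) → f = g) :
    HasT Γ (0, 1) 1 (1, 0) 1 := by
  let cx : ℂ ⊗[ℝ] Γ := 1 ⊗ₜ x
  let cy : ℂ ⊗[ℝ] Γ := 1 ⊗ₜ y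
  let cn : ℂ ⊗[ℝ] Γ := 1 ⊗ₜ n
  let i : ℂ ⊗[ℝ] Γ := algebraMap ℂ _ Complex.I
  have hi : i * i = -1 := by
    simp only [i, ← map_mul, Complex.I_mul_I, map_neg, map_one]
  have hxy2 : (cx ^ 2 + cy ^ 2) * cn = 1 := by
    have : (1 : ℂ) ⊗ₜ[ℝ] ((x ^ 2 + y ^ 2) * n) = (cx ^ 2 + cy ^ 2) * cn := by
      simp [cx, cy, cn, TensorProduct.tmul_add, Algebra.TensorProduct.tmul_pow, add_mul]
    rw [← this, hxy]; rfl
  have hu : (cx + i * cy) * ((cx - i * cy) * cn) = 1 := by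
    linear_combination hxy2 - cy ^ 2 * cn * hi
  have hv : (cx - i * cy) * ((cx + i * cy) * cn) = 1 := by
    linear_combination hxy2 - cy ^ 2 * cn * hi
  let u : (ℂ ⊗[ℝ] Γ)ˣ := ⟨_, _, hu, (mul_comm _ _).trans hu⟩
  let v : (ℂ ⊗[ℝ] Γ)ˣ := ⟨_, _, hv, (mul_comm _ _).trans hv⟩
  let g : TL →ₐ[ℂ] (ℂ ⊗[ℝ] Γ) := tlLift u v
  have g1 : g (mo (1, 0) 1) = cx + i * cy := tlLift_1 _ _
  have g2 : g (mo (0, 1) 1) = cx - i * cy := tlLift_2 _ _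
  obtain ⟨T1, hT1⟩ : ∃ T, T = mo (1, 0) 1 := ⟨_, rfl⟩
  obtain ⟨T2, hT2⟩ : ∃ T, T = mo (0, 1) 1 := ⟨_, rfl⟩
  have hTT : T1 * T2 * mo (-1, -1) 1 = 1 := by
    rw [hT1, hT2, mo_mul, mo_mul]; simp; rfl
  rw [← hT1] at g1
  rw [← hT2] at g2
  obtain ⟨j, hjd⟩ : ∃ j, j = algebraMap ℂ TL Complex.I := ⟨_, rfl⟩
  obtain ⟨h, hhd⟩ : ∃ h, h = algebraMap ℂ TL (1 / 2) := ⟨_, rfl⟩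
  have hj : j * j = -1 := by
    rw [hjd, ← map_mul, Complex.I_mul_I, map_neg, map_one]
  have hh : h * 2 = 1 := by
    have : (2 : TL) = algebraMap ℂ TL 2 := (map_ofNat _ 2).symm
    rw [this, hhd, ← map_mul, ← map_one (algebraMap ℂ TL)]; congr 1; norm_num
  obtain ⟨f, f0, f1⟩ := hpt TL (h * (T1 + T2)) (-(j * h) * (T1 - T2)) (mo (-1, -1) 1) (by
    linear_combination h ^ 2 * (T1 - T2) ^ 2 * (mo (-1, -1) 1) * hj + hTT +
      (2 * h + 1) * (T1 * T2 * mo (-1, -1) 1) * hh)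
  let F := cxLift f
  have Fx : F cx = h * (T1 + T2) := by
    simp only [F, cx, cxLift_tmul, map_one, one_mul, f0]
  have Fy : F cy = -(j * h) * (T1 - T2) := by
    simp only [F, cy, cxLift_tmul, map_one, one_mul, f1]
  have Fi : F i = j := by rw [hjd]; exact F.commutes _
  have F1 : F (cx + i * cy) = T1 := by
    rw [map_add, map_mul, Fx, Fy, Fi]
    linear_combination -h * (T1 - T2) * hj + T1 * hh
  have F2 : F (cx - i * cy) = T2 := by
    rw [map_sub, map_mul, Fx, Fy, Fi]
    linear_combination h * (T1 - T2) * hj + T2 * hh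
  have Fg : F.comp g = AlgHom.id ℂ TL := by
    apply tl_algHom_ext
    · rw [AlgHom.comp_apply, ← hT1, g1, F1]; rfl
    · rw [AlgHom.comp_apply, ← hT2, g2, F2]; rfl
  have gj : g j = i := by rw [hjd]; exact g.commutes _
  have gh : g h * 2 = 1 := by
    have := congrArg g hh
    rwa [map_mul, map_one, map_ofNat] at this
  have gF : g.comp F = AlgHom.id ℂ _ := by
    apply hext
    · change g (F cx) = cx
      rw [Fx, map_mul, map_add, g1, g2]
      linear_combination cx * gh
    · change g (F cy) = cy
      rw [Fy, map_mul, map_neg, map_mul, map_sub, g1, g2, gj]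
      linear_combination -cy * i * i * gh - cy * hi
  have hcx : tau Γ cx = cx := by simp [cx, tau_tmul]
  have hcy : tau Γ cy = cy := by simp [cy, tau_tmul]
  have hci : tau Γ i = -i := by
    simp only [i]; rw [tau_algebraMap, Complex.conj_I, map_neg]
  refine ⟨AlgEquiv.ofAlgHom F g Fg gF, ?_, ?_⟩
  · change F (tau _ (g _)) = _
    rw [← hT1, ← hT2, g1, map_add (tau Γ), map_mul (tau Γ), hcx, hcy, hci]
    have e : cx + -i * cy = cx - i * cy := by ring
    exact (congrArg F e).trans F2
  · change F (tau _ (g _)) = _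
    rw [← hT1, ← hT2, g2, map_sub (tau Γ), map_mul (tau Γ), hcx, hcy, hci]
    have e : cx - -i * cy = cx + i * cy := by ring
    exact (congrArg F e).trans F1

theorem punctured_hasT : HasT PuncturedPlane (0, 1) 1 (1, 0) 1 := by
  let q : MvPolynomial (Fin 2) ℝ := X 0 ^ 2 + X 1 ^ 2
  refine plane_hasT PuncturedPlane (algebraMap _ _ (X 0 : MvPolynomial (Fin 2) ℝ))
    (algebraMap _ _ (X 1 : MvPolynomial (Fin 2) ℝ)) (IsLocalization.Away.invSelf q) ?_ ?_ ?_
  · rw [← map_pow, ← map_pow, ← map_add]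
    exact IsLocalization.Away.mul_invSelf q
  · intro R _ _ a b c h
    have hq : aeval ![a, b] q = a ^ 2 + b ^ 2 := by simp [q]
    have hu : IsUnit (aeval ![a, b] q) := by rw [hq]; exact IsUnit.of_mul_eq_one _ h
    refine ⟨IsLocalization.liftAlgHom (M := Submonoid.powers q) (f := aeval ![a, b]) ?_, ?_, ?_⟩
    · rintro ⟨y, k, rfl⟩
      simp only [map_pow]
      exact hu.pow k
    · rw [IsLocalization.liftAlgHom_apply, IsLocalization.lift_eq]; simp
    · rw [IsLocalization.liftAlgHom_apply, IsLocalization.lift_eq]; simp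
  · intro R _ _ _ _ f g h0 h1
    apply cx_ext
    let f' : PuncturedPlane →ₐ[ℝ] R := (f.restrictScalars ℝ).comp Algebra.TensorProduct.includeRight
    let g' : PuncturedPlane →ₐ[ℝ] R := (g.restrictScalars ℝ).comp Algebra.TensorProduct.includeRight
    have e : f'.comp (IsScalarTower.toAlgHom ℝ (MvPolynomial (Fin 2) ℝ) PuncturedPlane) =
        g'.comp (IsScalarTower.toAlgHom ℝ (MvPolynomial (Fin 2) ℝ) PuncturedPlane) := by
      apply MvPolynomial.algHom_ext
      intro i
      fin_cases i
      · exact h0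
      · exact h1
    have e2 : (f' : PuncturedPlane →+* R) = (g' : PuncturedPlane →+* R) := by
      apply IsLocalization.ringHom_ext (Submonoid.powers q)
      apply RingHom.ext
      intro p
      exact DFunLike.congr_fun e p
    intro a
    exact DFunLike.congr_fun e2 a

theorem h00 : HasT (Gamma 0 ⊗[ℝ] Gamma 0) (1, 0) 1 (0, 1) 1 := by
  obtain ⟨u, hu, h⟩ := gamma0
  exact hasT_prod hu hu _ _ _ _ h h

theorem h01 : HasT (Gamma 0 ⊗[ℝ] Gamma 1) (1, 0) 1 (0, -1) 1 := by
  obtain ⟨u, hu, h⟩ := gamma0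
  obtain ⟨v, hv, k⟩ := gamma1
  exact hasT_prod hu hv _ _ _ _ h k

theorem h02 : HasT (Gamma 0 ⊗[ℝ] Gamma 2) (1, 0) 1 (0, -1) (-1) := by
  obtain ⟨u, hu, h⟩ := gamma0
  obtain ⟨v, hv, k⟩ := gamma2
  exact hasT_prod hu hv _ _ _ _ h k

theorem h11 : HasT (Gamma 1 ⊗[ℝ] Gamma 1) (-1, 0) 1 (0, -1) 1 := by
  obtain ⟨v, hv, k⟩ := gamma1
  exact hasT_prod hv hv _ _ _ _ k k

theorem h12 : HasT (Gamma 1 ⊗[ℝ] Gamma 2) (-1, 0) 1 (0, -1) (-1) := by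
  obtain ⟨u, hu, h⟩ := gamma1
  obtain ⟨v, hv, k⟩ := gamma2
  exact hasT_prod hu hv _ _ _ _ h k

theorem h22 : HasT (Gamma 2 ⊗[ℝ] Gamma 2) (-1, 0) (-1) (0, -1) (-1) := by
  obtain ⟨v, hv, k⟩ := gamma2
  exact hasT_prod hv hv _ _ _ _ k k

theorem pt0 : Nonempty (Gamma 0 →ₐ[ℝ] ℝ) := by
  obtain ⟨f, -⟩ := quot_pt (conic13 0) (1 : ℝ) (1 : ℝ) (by simp [conic13])
  exact ⟨f⟩

theorem pt1 : Nonempty (Gamma 1 →ₐ[ℝ] ℝ) := by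
  obtain ⟨f, -⟩ := quot_pt (conic13 1) (1 : ℝ) (0 : ℝ) (by simp [conic13])
  exact ⟨f⟩

theorem pt2 (f : Gamma 2 →ₐ[ℝ] ℝ) : False := by
  have hp : conic13 2 = X 0 ^ 2 + X 1 ^ 2 + 1 := rfl
  have := mk_rel _ _ hp
  have := congrArg f this
  simp only [map_add, map_pow, map_one, map_zero] at this
  nlinarith [sq_nonneg (f (Ideal.Quotient.mk _ (X 0))), sq_nonneg (f (Ideal.Quotient.mk _ (X 1)))]

section
variable {A B : Type} [CommRing A] [Algebra ℝ A] [CommRing B] [Algebra ℝ B]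

theorem pt_prod (hA : Nonempty (A →ₐ[ℝ] ℝ)) (hB : Nonempty (B →ₐ[ℝ] ℝ)) :
    Nonempty (A ⊗[ℝ] B →ₐ[ℝ] ℝ) := by
  obtain ⟨f⟩ := hA
  obtain ⟨g⟩ := hB
  exact ⟨Algebra.TensorProduct.productMap f g⟩

theorem notIso_pt (hA : Nonempty (A →ₐ[ℝ] ℝ)) : NotIso A (B ⊗[ℝ] Gamma 2) := by
  obtain ⟨f⟩ := hA
  exact ⟨fun e => pt2 ((f.comp e.symm.toAlgHom).comp
    (Algebra.TensorProduct.includeRight : Gamma 2 →ₐ[ℝ] B ⊗[ℝ] Gamma 2))⟩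


/-- conjugacy invariants -/
theorem notIso_one {p q α β p' q' α' β'} (hA : HasT A p α q β) (hB : HasT B p' α' q' β')
    (h1 : ∀ m : ℤ × ℤ, m.1 • p + m.2 • q = m) (m' : ℤ × ℤ) (h2 : m'.1 • p' + m'.2 • q' ≠ m') :
    NotIso A B := ⟨fun e => by
  obtain ⟨P, hs, ha, hP⟩ := conj_of_iso hA hB e
  obtain ⟨m, rfl⟩ := hs m'
  exact h2 (by rw [← hP, h1])⟩

theorem notIso_neg {p q α β p' q' α' β'} (hA : HasT A p α q β) (hB : HasT B p' α' q' β')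
    (h1 : ∀ m : ℤ × ℤ, (m.1 • p + m.2 • q) + m = 0)
    (m' : ℤ × ℤ) (h2 : (m'.1 • p' + m'.2 • q') + m' ≠ 0) :
    NotIso A B := ⟨fun e => by
  obtain ⟨P, hs, ha, hP⟩ := conj_of_iso hA hB e
  obtain ⟨m, rfl⟩ := hs m'
  have h0 : P 0 = 0 := by simpa using ha 0 0
  exact h2 (by rw [← hP, ← ha, h1, h0])⟩

theorem notIso_two {p q α β p' q' α' β'} (hA : HasT A p α q β) (hB : HasT B p' α' q' β')
    (h1 : ∀ m : ℤ × ℤ, ∃ k, m.1 • p + m.2 • q = m + (k + k))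
    (m' : ℤ × ℤ) (h2 : ∀ k, m'.1 • p' + m'.2 • q' ≠ m' + (k + k)) :
    NotIso A B := ⟨fun e => by
  obtain ⟨P, hs, ha, hP⟩ := conj_of_iso hA hB e
  obtain ⟨m, rfl⟩ := hs m'
  obtain ⟨k, hk⟩ := h1 m
  exact h2 (P k) (by rw [← hP, hk, ha, ha])⟩

theorem NotIso.symm (h : NotIso A B) : NotIso B A := ⟨fun e => h.false e.symm⟩
end



theorem diag_two (m : ℤ × ℤ) :
    ∃ k : ℤ × ℤ, m.1 • ((1, 0) : ℤ × ℤ) + m.2 • ((0, -1) : ℤ × ℤ) = m + (k + k) := by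
  refine ⟨(0, -m.2), ?_⟩
  ext <;> simp

theorem swap_two (k : ℤ × ℤ) :
    ((1, 0) : ℤ × ℤ).1 • ((0, 1) : ℤ × ℤ) + ((1, 0) : ℤ × ℤ).2 • ((1, 0) : ℤ × ℤ) ≠
      (1, 0) + (k + k) := by
  intro h
  have := congrArg Prod.snd h
  simp at this
  omega

/-- The surface `(𝔸¹_ℂ ∖ {0})²` has exactly six isomorphism classes of real forms:
`Γ₁×Γ₁`, `Γ₁×Γ₂`, `Γ₁×Γ₃`, `Γ₂×Γ₂`, `Γ₃×Γ₃` and `𝔸²_ℝ ∖ {x² + y² = 0}`; moreover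
`Γ₂×Γ₃ ≅ Γ₃×Γ₃`. -/
theorem six_real_forms_of_torus :
    -- the six algebras are pairwise non-isomorphic
    (NotIso (Gamma 0 ⊗[ℝ] Gamma 0) (Gamma 0 ⊗[ℝ] Gamma 1) ∧
     NotIso (Gamma 0 ⊗[ℝ] Gamma 0) (Gamma 0 ⊗[ℝ] Gamma 2) ∧
     NotIso (Gamma 0 ⊗[ℝ] Gamma 0) (Gamma 1 ⊗[ℝ] Gamma 1) ∧
     NotIso (Gamma 0 ⊗[ℝ] Gamma 0) (Gamma 2 ⊗[ℝ] Gamma 2) ∧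
     NotIso (Gamma 0 ⊗[ℝ] Gamma 0) PuncturedPlane ∧
     NotIso (Gamma 0 ⊗[ℝ] Gamma 1) (Gamma 0 ⊗[ℝ] Gamma 2) ∧
     NotIso (Gamma 0 ⊗[ℝ] Gamma 1) (Gamma 1 ⊗[ℝ] Gamma 1) ∧
     NotIso (Gamma 0 ⊗[ℝ] Gamma 1) (Gamma 2 ⊗[ℝ] Gamma 2) ∧
     NotIso (Gamma 0 ⊗[ℝ] Gamma 1) PuncturedPlane ∧
     NotIso (Gamma 0 ⊗[ℝ] Gamma 2) (Gamma 1 ⊗[ℝ] Gamma 1) ∧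
     NotIso (Gamma 0 ⊗[ℝ] Gamma 2) (Gamma 2 ⊗[ℝ] Gamma 2) ∧
     NotIso (Gamma 0 ⊗[ℝ] Gamma 2) PuncturedPlane ∧
     NotIso (Gamma 1 ⊗[ℝ] Gamma 1) (Gamma 2 ⊗[ℝ] Gamma 2) ∧
     NotIso (Gamma 1 ⊗[ℝ] Gamma 1) PuncturedPlane ∧
     NotIso (Gamma 2 ⊗[ℝ] Gamma 2) PuncturedPlane) ∧
    -- each is a real form of the two-dimensional torus
    (IsRealFormTorus (Gamma 0 ⊗[ℝ] Gamma 0) ∧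
     IsRealFormTorus (Gamma 0 ⊗[ℝ] Gamma 1) ∧
     IsRealFormTorus (Gamma 0 ⊗[ℝ] Gamma 2) ∧
     IsRealFormTorus (Gamma 1 ⊗[ℝ] Gamma 1) ∧
     IsRealFormTorus (Gamma 2 ⊗[ℝ] Gamma 2) ∧
     IsRealFormTorus PuncturedPlane) ∧
    -- every real form is isomorphic to one of the six
    (∀ (A : Type) [CommRing A] [Algebra ℝ A], IsRealFormTorus A →
      Nonempty (A ≃ₐ[ℝ] Gamma 0 ⊗[ℝ] Gamma 0) ∨
      Nonempty (A ≃ₐ[ℝ] Gamma 0 ⊗[ℝ] Gamma 1) ∨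
      Nonempty (A ≃ₐ[ℝ] Gamma 0 ⊗[ℝ] Gamma 2) ∨
      Nonempty (A ≃ₐ[ℝ] Gamma 1 ⊗[ℝ] Gamma 1) ∨
      Nonempty (A ≃ₐ[ℝ] Gamma 2 ⊗[ℝ] Gamma 2) ∨
      Nonempty (A ≃ₐ[ℝ] PuncturedPlane)) ∧
    -- Γ₂ ⊗ Γ₃ is isomorphic to Γ₃ ⊗ Γ₃
    Nonempty ((Gamma 1 ⊗[ℝ] Gamma 2) ≃ₐ[ℝ] Gamma 2 ⊗[ℝ] Gamma 2) := by
  refine ⟨⟨?_, ?_, ?_, ?_, ?_, ?_, ?_, ?_, ?_, ?_, ?_, ?_, ?_, ?_, ?_⟩,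
    ⟨h00.realForm, h01.realForm, h02.realForm, h11.realForm, h22.realForm,
      punctured_hasT.realForm⟩, ?_, ?_⟩
  · exact notIso_one h00 h01 (by simp) (0, 1) (by decide)
  · exact notIso_one h00 h02 (by simp) (0, 1) (by decide)
  · exact notIso_one h00 h11 (by simp) (0, 1) (by decide)
  · exact notIso_one h00 h22 (by simp) (0, 1) (by decide)
  · exact notIso_one h00 punctured_hasT (by simp) (0, 1) (by decide)
  · exact notIso_pt (pt_prod pt0 pt1)
  · exact (notIso_neg h11 h01 (by simp) (1, 0) (by decide)).symm
  · exact (notIso_neg h22 h01 (by simp) (1, 0) (by decide)).symm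
  · exact notIso_two h01 punctured_hasT diag_two (1, 0) swap_two
  · exact (notIso_neg h11 h02 (by simp) (1, 0) (by decide)).symm
  · exact (notIso_neg h22 h02 (by simp) (1, 0) (by decide)).symm
  · exact notIso_two h02 punctured_hasT diag_two (1, 0) swap_two
  · exact notIso_pt (pt_prod pt1 pt1)
  · exact notIso_neg h11 punctured_hasT (by simp) (1, 0) (by decide)
  · exact notIso_neg h22 punctured_hasT (by simp) (1, 0) (by decide)
  · intro A _ _ hA
    obtain ⟨p, α, q, β, h⟩ := exists_hasT hA
    rcases h.classify with h | h | h | h | h | h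
    · exact Or.inl (iso_of_hasT h h00)
    · exact Or.inr (Or.inl (iso_of_hasT h h01))
    · exact Or.inr (Or.inr (Or.inl (iso_of_hasT h h02)))
    · exact Or.inr (Or.inr (Or.inr (Or.inl (iso_of_hasT h h11))))
    · exact Or.inr (Or.inr (Or.inr (Or.inr (Or.inl (iso_of_hasT h h22)))))
    · exact Or.inr (Or.inr (Or.inr (Or.inr (Or.inr (iso_of_hasT h punctured_hasT)))))
  · have := h12.change1 (1, 1) (0, 1) (by simp) (-1, 0) (0, -1) (by simp) (by simp)
    simp only [zpow_one, zpow_zero, one_mul] at this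
    exact iso_of_hasT this h22
end

section
/- Let Γ₁ = ℝ[x,y]/(xy − 1), Γ₂ = ℝ[x,y]/(x² + y² − 1), Γ₃ = ℝ[x,y]/(x² + y² + 1). The four ℝ-algebras ℝ[t] ⊗_ℝ Γ₁, ℝ[t] ⊗_ℝ Γ₂, ℝ[t] ⊗_ℝ Γ₃, and the degree-zero part of the localization of the standardly graded polynomial ring ℝ[x,y,z] away from the element x² + y² (the coordinate ring of ℙ²_ℝ ∖ {x² + y² = 0}) are pairwise non-isomorphic, the complexification of each is isomorphic as a ℂ-algebra to ℂ[x][T, T⁻¹] (polynomials in x with Laurent-polynomial coefficients), and every commutative ℝ-algebra whose complexification is isomorphic to ℂ[x][T, T⁻¹] as a ℂ-algebra is isomorphic to one of these four. (Thus the surface 𝔸¹_ℂ × (𝔸¹_ℂ ∖ {0}) has exactly four isomorphism classes of real forms.) -/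
open MvPolynomial
open scoped TensorProduct

attribute [local instance] MvPolynomial.gradedAlgebra

/-- The defining polynomials of the three real conics `xy = 1`, `x² + y² = 1`,
`x² + y² = -1`. -/
noncomputable def conic14 : Fin 3 → MvPolynomial (Fin 2) ℝ :=
  ![X 0 * X 1 - 1,
    X 0 ^ 2 + X 1 ^ 2 - 1,
    X 0 ^ 2 + X 1 ^ 2 + 1]

/-- The coordinate rings `Γ₁, Γ₂, Γ₃` of the three real forms of `𝔸¹_ℂ ∖ {0}`. -/
noncomputable abbrev Gamma14 (i : Fin 3) :=
  MvPolynomial (Fin 2) ℝ ⧸ Ideal.span {conic14 i}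

/-- The coordinate ring of `ℙ²_ℝ ∖ {x² + y² = 0}`: the degree-zero part of the
localization of the standardly graded polynomial ring `ℝ[x,y,z]` away from `x² + y²`. -/
noncomputable abbrev P2MinusConic :=
  HomogeneousLocalization.Away (MvPolynomial.homogeneousSubmodule (Fin 3) ℝ)
    ((X 0) ^ 2 + (X 1) ^ 2 : MvPolynomial (Fin 3) ℝ)

noncomputable instance : Algebra ℝ P2MinusConic :=
  ((algebraMap ((MvPolynomial.homogeneousSubmodule (Fin 3) ℝ) 0) P2MinusConic).comp
    (algebraMap ℝ _)).toAlgebra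

/-- `A` is a real form of `ℂ[x][T, T⁻¹]`, the coordinate ring of
`𝔸¹_ℂ × (𝔸¹_ℂ ∖ {0})`. -/
def IsRealFormA1Star (A : Type) [CommRing A] [Algebra ℝ A] : Prop :=
  Nonempty ((ℂ ⊗[ℝ] A) ≃ₐ[ℂ] LaurentPolynomial (Polynomial ℂ))

/-- `A` and `B` are non-isomorphic real algebras. -/
def NotIso14 (A B : Type) [CommRing A] [Algebra ℝ A] [CommRing B] [Algebra ℝ B] : Prop :=
  IsEmpty (A ≃ₐ[ℝ] B)

noncomputable section RF14

abbrev LL14 := LaurentPolynomial ℂ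
abbrev BB14 := Polynomial LL14

def mono14 (a : ℂ) (n : ℤ) : LL14 := LaurentPolynomial.C a * LaurentPolynomial.T n

lemma mono14_mul (a b : ℂ) (n m : ℤ) : mono14 a n * mono14 b m = mono14 (a * b) (n + m) := by
  simp only [mono14, map_mul, LaurentPolynomial.T_add]; ring

lemma mono14_one : mono14 1 0 = 1 := by simp [mono14]

lemma mono14_C (a : ℂ) : mono14 a 0 = LaurentPolynomial.C a := by simp [mono14]

lemma mono14_T (n : ℤ) : mono14 1 n = LaurentPolynomial.T n := by simp [mono14]

lemma mono14_inj {a b : ℂ} {n m : ℤ} (ha : a ≠ 0) (h : mono14 a n = mono14 b m) :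
    a = b ∧ n = m := by
  simp only [mono14, ← LaurentPolynomial.single_eq_C_mul_T] at h
  have h1 := congrArg (fun f : LL14 => f.coeff n) h
  simp only [AddMonoidAlgebra.coeff_single, Finsupp.single_apply, if_true] at h1
  split_ifs at h1 with h2
  · exact ⟨h1, h2.symm⟩
  · exact absurd h1 ha

lemma mono14_unit {a : ℂ} (ha : a ≠ 0) (n : ℤ) : mono14 a n * mono14 a⁻¹ (-n) = 1 := by
  rw [mono14_mul, mul_inv_cancel₀ ha, add_neg_cancel, mono14_one]

lemma isUnit_mono14 {a : ℂ} (ha : a ≠ 0) (n : ℤ) : IsUnit (mono14 a n) :=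
  IsUnit.of_mul_eq_one _ (mono14_unit ha n)

def monoU14 (a : ℂ) (ha : a ≠ 0) (n : ℤ) : LL14ˣ :=
  ⟨mono14 a n, mono14 a⁻¹ (-n), mono14_unit ha n, by rw [mul_comm]; exact mono14_unit ha n⟩

lemma monoU14_zpow (a : ℂ) (ha : a ≠ 0) (n k : ℤ) :
    ((monoU14 a ha n ^ k : LL14ˣ) : LL14) = mono14 (a ^ k) (n * k) := by
  induction k using Int.induction_on with
  | zero => simp [mono14_one]
  | succ i ih =>
    rw [zpow_add_one, Units.val_mul, ih, monoU14, mono14_mul, zpow_add_one₀ ha, mul_add, mul_one]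
  | pred i ih =>
    rw [zpow_sub_one, Units.val_mul, ih, monoU14, Units.inv_mk, mono14_mul, zpow_sub_one₀ ha,
      mul_sub, mul_one]; rfl

lemma map_T14 (φ : LL14 →+* LL14) {a : ℂ} (ha : a ≠ 0) {n : ℤ}
    (h : φ (LaurentPolynomial.T 1) = mono14 a n) (k : ℤ) :
    φ (LaurentPolynomial.T k) = mono14 (a ^ k) (n * k) := by
  have h1 : Units.map (φ : LL14 →* LL14) (monoU14 1 one_ne_zero 1) = monoU14 a ha n := by
    ext1
    simp only [Units.coe_map, monoU14, mono14_T]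
    exact h
  rw [← monoU14_zpow a ha, ← h1, ← map_zpow]
  simp only [Units.coe_map, monoU14_zpow]
  simp [mono14]

lemma unit_LL14 (u : LL14) (hu : IsUnit u) : ∃ a : ℂ, a ≠ 0 ∧ ∃ n : ℤ, u = mono14 a n := by
  obtain ⟨v, huv⟩ := hu.exists_right_inv
  obtain ⟨n, f, hf⟩ := LaurentPolynomial.exists_T_pow u
  obtain ⟨m, g, hg⟩ := LaurentPolynomial.exists_T_pow v
  have h : f * g = Polynomial.X ^ (n + m) := by
    apply Polynomial.toLaurent_injective
    rw [map_mul, hf, hg, Polynomial.toLaurent_X_pow]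
    push_cast
    rw [LaurentPolynomial.T_add]
    linear_combination (LaurentPolynomial.T n * LaurentPolynomial.T m) * huv
  have h2 : f ∣ Polynomial.X ^ (n + m) := ⟨g, h.symm⟩
  obtain ⟨i, hi, hfi⟩ := (dvd_prime_pow Polynomial.prime_X _).1 h2
  obtain ⟨w, hw⟩ := hfi.symm
  obtain ⟨c, hc, hcw⟩ := Polynomial.isUnit_iff.1 w.isUnit
  refine ⟨c, hc.ne_zero, (i : ℤ) - n, ?_⟩
  have h3 : u = Polynomial.toLaurent f * LaurentPolynomial.T (-n) := by
    rw [hf, LaurentPolynomial.mul_T_assoc]; simp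
  rw [h3, ← hw, ← hcw, map_mul, Polynomial.toLaurent_X_pow, Polynomial.toLaurent_C, mono14,
    LaurentPolynomial.T_sub]
  ring

/-- Two ring homs from `LL14` agreeing on constants and `T 1` are equal. -/
lemma LL14_hom_ext {R : Type*} [CommRing R] {f g : LL14 →+* R}
    (hC : ∀ z, f (LaurentPolynomial.C z) = g (LaurentPolynomial.C z))
    (hT : f (LaurentPolynomial.T 1) = g (LaurentPolynomial.T 1)) : f = g := by
  have hU : Units.map (f : LL14 →* R) (monoU14 1 one_ne_zero 1)
      = Units.map (g : LL14 →* R) (monoU14 1 one_ne_zero 1) := by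
    ext1
    simp only [Units.coe_map, monoU14, mono14_T]
    exact hT
  have hk : ∀ k : ℤ, f (LaurentPolynomial.T k) = g (LaurentPolynomial.T k) := by
    intro k
    have := congrArg (fun u : Rˣ => ((u ^ k : Rˣ) : R)) hU
    simp only [← map_zpow, Units.coe_map, monoU14_zpow] at this
    simpa [mono14] using this
  refine RingHom.ext fun x => ?_
  induction x using LaurentPolynomial.induction_on' with
  | add p q hp hq => rw [map_add, map_add, hp, hq]
  | C_mul_T n a => rw [map_mul, map_mul, hC, hk]

lemma BB14_hom_ext {R : Type*} [CommRing R] {f g : BB14 →+* R}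
    (hC : ∀ z, f (Polynomial.C (LaurentPolynomial.C z)) = g (Polynomial.C (LaurentPolynomial.C z)))
    (hT : f (Polynomial.C (LaurentPolynomial.T 1)) = g (Polynomial.C (LaurentPolynomial.T 1)))
    (hX : f Polynomial.X = g Polynomial.X) : f = g := by
  apply Polynomial.ringHom_ext' _ hX
  exact LL14_hom_ext hC hT

end RF14

noncomputable section RF14b

lemma auto14_range (φ : BB14 ≃+* BB14) (l : LL14) :
    ∃ l' : LL14, φ (Polynomial.C l) = Polynomial.C l' := by
  induction l using LaurentPolynomial.induction_on' with
  | add p q hp hq =>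
    obtain ⟨p', hp⟩ := hp
    obtain ⟨q', hq⟩ := hq
    exact ⟨p' + q', by rw [map_add, map_add, hp, hq, map_add]⟩
  | C_mul_T n a =>
    by_cases ha : a = 0
    · exact ⟨0, by simp [ha]⟩
    · have h1 : IsUnit (φ (Polynomial.C (mono14 a n))) :=
        ((isUnit_mono14 ha n).map Polynomial.C).map φ
      obtain ⟨l', -, h⟩ := Polynomial.isUnit_iff.1 h1
      exact ⟨l', h.symm⟩

def resL14 (φ : BB14 ≃+* BB14) : LL14 →+* LL14 :=
  (Polynomial.evalRingHom 0).comp ((φ : BB14 →+* BB14).comp Polynomial.C)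

lemma resL14_spec (φ : BB14 ≃+* BB14) (l : LL14) :
    φ (Polynomial.C l) = Polynomial.C (resL14 φ l) := by
  obtain ⟨l', h⟩ := auto14_range φ l
  simp [resL14, h]

lemma resL14_inj (φ : BB14 ≃+* BB14) : Function.Injective (resL14 φ) := by
  intro a b h
  apply Polynomial.C_injective
  apply φ.injective
  rw [resL14_spec, resL14_spec, h]

lemma auto14_eq (φ : BB14 ≃+* BB14) (Q : BB14) :
    φ Q = (Q.map (resL14 φ)).comp (φ Polynomial.X) := by
  induction Q using Polynomial.induction_on' with
  | add p q hp hq => simp [hp, hq]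
  | monomial n a =>
    rw [← Polynomial.C_mul_X_pow_eq_monomial]
    simp [resL14_spec]

lemma auto14_X (φ : BB14 ≃+* BB14) :
    ∃ u p : LL14, IsUnit u ∧ φ Polynomial.X = Polynomial.C u * Polynomial.X + Polynomial.C p := by
  have hdeg : ∀ Q, (φ Q).natDegree = Q.natDegree * (φ Polynomial.X).natDegree := by
    intro Q
    rw [auto14_eq φ Q, Polynomial.natDegree_comp,
      Polynomial.natDegree_map_eq_of_injective (resL14_inj φ)]
  have h1 := hdeg (φ.symm Polynomial.X)
  rw [φ.apply_symm_apply, Polynomial.natDegree_X] at h1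
  have hd2 := Nat.eq_one_of_mul_eq_one_left h1.symm
  have hd1 := Nat.eq_one_of_mul_eq_one_right h1.symm
  have e1 := Polynomial.eq_X_add_C_of_natDegree_le_one hd1.le
  have e2 := Polynomial.eq_X_add_C_of_natDegree_le_one hd2.le
  obtain ⟨u, p, e2⟩ : ∃ u p, φ Polynomial.X = Polynomial.C u * Polynomial.X + Polynomial.C p :=
    ⟨_, _, e2⟩
  obtain ⟨v, q, e1⟩ : ∃ u p, φ.symm Polynomial.X = Polynomial.C u * Polynomial.X + Polynomial.C p :=
    ⟨_, _, e1⟩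
  refine ⟨u, p, ?_, e2⟩
  have e3 := congrArg φ e1
  rw [φ.apply_symm_apply, map_add, map_mul, resL14_spec, resL14_spec, e2] at e3
  have e4 := congrArg (fun f : BB14 => f.coeff 1) e3
  simp [Polynomial.coeff_C_succ, mul_add, Polynomial.coeff_C, Polynomial.coeff_X] at e4
  exact IsUnit.of_mul_eq_one _ ((mul_comm _ _).trans e4.symm)

lemma resL14_C (φ : BB14 ≃+* BB14) (θ : ℂ → ℂ)
    (hθ : ∀ z, φ (Polynomial.C (LaurentPolynomial.C z)) = Polynomial.C (LaurentPolynomial.C (θ z)))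
    (z : ℂ) : resL14 φ (LaurentPolynomial.C z) = LaurentPolynomial.C (θ z) := by
  apply Polynomial.C_injective
  rw [← resL14_spec, hθ]

lemma resL14_mono (φ : BB14 ≃+* BB14) (θ : ℂ → ℂ)
    (hθ : ∀ z, φ (Polynomial.C (LaurentPolynomial.C z)) = Polynomial.C (LaurentPolynomial.C (θ z)))
    {a : ℂ} (ha : a ≠ 0) {n : ℤ} (h : φ (Polynomial.C (LaurentPolynomial.T 1)) =
      Polynomial.C (mono14 a n))
    (z : ℂ) (k : ℤ) : resL14 φ (mono14 z k) = mono14 (θ z * a ^ k) (n * k) := by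
  have h' : resL14 φ (LaurentPolynomial.T 1) = mono14 a n := by
    apply Polynomial.C_injective
    rw [← resL14_spec, h]
  rw [mono14, map_mul, resL14_C φ θ hθ, map_T14 _ ha h', ← mono14_C, mono14_mul, zero_add]

lemma auto14_T (φ : BB14 ≃+* BB14) (θ : ℂ → ℂ)
    (hθ : ∀ z, φ (Polynomial.C (LaurentPolynomial.C z)) =
      Polynomial.C (LaurentPolynomial.C (θ z))) :
    ∃ a : ℂ, a ≠ 0 ∧ ∃ n : ℤ, (n = 1 ∨ n = -1) ∧
      φ (Polynomial.C (LaurentPolynomial.T 1)) = Polynomial.C (mono14 a n) := by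
  have key : ∀ χ : BB14 ≃+* BB14, ∃ a : ℂ, a ≠ 0 ∧ ∃ n : ℤ,
      χ (Polynomial.C (LaurentPolynomial.T 1)) = Polynomial.C (mono14 a n) := by
    intro χ
    have h1 : IsUnit (χ (Polynomial.C (LaurentPolynomial.T 1))) :=
      ((LaurentPolynomial.isUnit_T 1).map Polynomial.C).map χ
    obtain ⟨l', hl, h⟩ := Polynomial.isUnit_iff.1 h1
    obtain ⟨a, ha, n, hn⟩ := unit_LL14 l' hl
    exact ⟨a, ha, n, by rw [← h, hn]⟩
  obtain ⟨a, ha, n, h⟩ := key φ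
  obtain ⟨a', ha', n', h'⟩ := key φ.symm
  refine ⟨a, ha, n, ?_, h⟩
  have h2 := congrArg φ h'
  rw [φ.apply_symm_apply, resL14_spec, resL14_mono φ θ hθ ha h, ← mono14_T] at h2
  have h3 := (mono14_inj one_ne_zero (Polynomial.C_injective h2)).2
  exact Int.eq_one_or_neg_one_of_mul_eq_one h3.symm

/-- antilinear ring automorphisms of `BB14` -/
def Anti14 (σ : BB14 ≃+* BB14) : Prop :=
  ∀ z : ℂ, σ (Polynomial.C (LaurentPolynomial.C z)) =
    Polynomial.C (LaurentPolynomial.C (starRingEnd ℂ z))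

def StdInv14 (σ : BB14 ≃+* BB14) (n : ℤ) (ε : ℝ) (m : ℤ) : Prop :=
  σ (Polynomial.C (LaurentPolynomial.T 1)) = Polynomial.C (mono14 ε n) ∧
  σ Polynomial.X = Polynomial.C (LaurentPolynomial.T m) * Polynomial.X

lemma std14_unique (σ σ' ψ : BB14 ≃+* BB14) (hσ' : Anti14 σ')
    (hψ : ∀ z, ψ (Polynomial.C (LaurentPolynomial.C z)) = Polynomial.C (LaurentPolynomial.C z))
    (hc : ∀ b, ψ (σ b) = σ' (ψ b)) (n n' : ℤ) (ε ε' : ℝ) (m m' : ℤ)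
    (hε : ε = 1 ∨ ε = -1) (hε' : ε' = 1 ∨ ε' = -1)
    (h : StdInv14 σ n ε m) (h' : StdInv14 σ' n' ε' m') :
    n = n' ∧ (n = -1 → ε = ε' ∧ Even (m - m')) := by
  have hε0 : (ε : ℂ) ≠ 0 := by rcases hε with rfl | rfl <;> simp
  have hε0' : (ε' : ℂ) ≠ 0 := by rcases hε' with rfl | rfl <;> simp
  obtain ⟨c, hc0, k, hk, hT⟩ := auto14_T ψ id hψ
  obtain ⟨v, q, hv, hX⟩ := auto14_X ψ
  obtain ⟨d, hd, j, rfl⟩ := unit_LL14 v hv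
  have e1 := hc (Polynomial.C (LaurentPolynomial.T 1))
  rw [h.1, hT, resL14_spec, resL14_spec, resL14_mono ψ id hψ hc0 hT,
    resL14_mono σ' _ hσ' hε0' h'.1] at e1
  have e2 := mono14_inj (mul_ne_zero hε0 (zpow_ne_zero _ hc0)) (Polynomial.C_injective e1)
  have hn : n = n' := by
    have := e2.2
    rcases hk with rfl | rfl <;> linarith
  refine ⟨hn, fun hn1 => ⟨?_, ?_⟩⟩
  · have e3 := e2.1
    rw [hn1] at e3
    simp only [id, zpow_neg, zpow_one] at e3
    have e4 : (ε' : ℂ) ^ k = ε' := by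
      rcases hk with rfl | rfl
      · simp
      · rcases hε' with rfl | rfl <;> norm_num
    rw [e4] at e3
    have e5 : (ε : ℂ) = ε' * (Complex.normSq c : ℂ) := by
      rw [Complex.normSq_eq_conj_mul_self]
      field_simp at e3
      rw [e3]; ring
    have e6 : ε = ε' * Complex.normSq c := by exact_mod_cast e5
    have e7 := Complex.normSq_nonneg c
    rcases hε with rfl | rfl <;> rcases hε' with rfl | rfl <;> first | rfl | (exfalso; nlinarith)
  · have e3 := hc Polynomial.X
    rw [h.2, hX, map_mul, map_add, map_mul, hX, h'.2, resL14_spec, resL14_spec, resL14_spec,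
      ← mono14_T, resL14_mono ψ id hψ hc0 hT, resL14_mono σ' _ hσ' hε0' h'.1] at e3
    have e4 := congrArg (fun f : BB14 => f.coeff 1) e3
    simp [mul_add, Polynomial.coeff_C, Polynomial.coeff_X, ← mono14_T] at e4
    rw [mono14_mul, mono14_mul] at e4
    have e5 := (mono14_inj (mul_ne_zero (zpow_ne_zero _ hc0) hd) e4).2
    rw [← hn, hn1] at e5
    rcases hk with rfl | rfl
    · exact ⟨-j, by linarith⟩
    · exact ⟨j - m', by linarith⟩

end RF14b

noncomputable section RF14c

def mkHom14 {R : Type*} [CommRing R] [Algebra ℂ R] (t : Rˣ) (x : R) : BB14 →ₐ[ℂ] R :=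
  { Polynomial.eval₂RingHom (LaurentPolynomial.eval₂ (algebraMap ℂ R) t) x with
    commutes' := by
      intro z
      have : algebraMap ℂ BB14 z = Polynomial.C (LaurentPolynomial.C z) := rfl
      rw [this]
      simp }

lemma algebraMap_BB14 (z : ℂ) : algebraMap ℂ BB14 z = Polynomial.C (LaurentPolynomial.C z) := rfl

section
variable {R : Type*} [CommRing R] [Algebra ℂ R] (t : Rˣ) (x : R)

lemma mkHom14_C (z : ℂ) : mkHom14 t x (Polynomial.C (LaurentPolynomial.C z)) = algebraMap ℂ R z :=
  (mkHom14 t x).commutes z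

lemma mkHom14_T (n : ℤ) :
    mkHom14 t x (Polynomial.C (LaurentPolynomial.T n)) = ((t ^ n : Rˣ) : R) := by
  simp [mkHom14]

lemma mkHom14_X : mkHom14 t x Polynomial.X = x := by
  simp [mkHom14]
end

lemma BB14_algHom_ext {R : Type*} [CommRing R] [Algebra ℂ R] {f g : BB14 →ₐ[ℂ] R}
    (hT : f (Polynomial.C (LaurentPolynomial.T 1)) = g (Polynomial.C (LaurentPolynomial.T 1)))
    (hX : f Polynomial.X = g Polynomial.X) : f = g := by
  have : (f : BB14 →+* R) = g := by
    apply BB14_hom_ext _ hT hX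
    intro z
    rw [← algebraMap_BB14]
    exact (f.commutes z).trans (g.commutes z).symm
  exact AlgHom.ext fun b => RingHom.congr_fun this b

def monoUB14 (a : ℂ) (ha : a ≠ 0) (n : ℤ) : BB14ˣ :=
  Units.map (Polynomial.C : LL14 →+* BB14).toMonoidHom (monoU14 a ha n)

lemma monoUB14_val (a : ℂ) (ha : a ≠ 0) (n : ℤ) :
    (monoUB14 a ha n : BB14) = Polynomial.C (mono14 a n) := rfl

def psiT14 (c : ℂ) (hc : c ≠ 0) : BB14 ≃ₐ[ℂ] BB14 :=
  AlgEquiv.ofAlgHom (mkHom14 (monoUB14 c hc 1) Polynomial.X)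
    (mkHom14 (monoUB14 c⁻¹ (inv_ne_zero hc) 1) Polynomial.X)
    (by
      apply BB14_algHom_ext
      · simp only [AlgHom.comp_apply, mkHom14_T, zpow_one, monoUB14_val, mono14, map_mul, mkHom14_C,
          algebraMap_BB14, AlgHom.id_apply]
        rw [← mul_assoc, ← map_mul, ← map_mul LaurentPolynomial.C, inv_mul_cancel₀ hc]; simp
      · simp [mkHom14_X])
    (by
      apply BB14_algHom_ext
      · simp only [AlgHom.comp_apply, mkHom14_T, zpow_one, monoUB14_val, mono14, map_mul, mkHom14_C,
          algebraMap_BB14, AlgHom.id_apply]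
        rw [← mul_assoc, ← map_mul, ← map_mul LaurentPolynomial.C, mul_inv_cancel₀ hc]; simp
      · simp [mkHom14_X])

lemma psiT14_T (c : ℂ) (hc : c ≠ 0) : psiT14 c hc (Polynomial.C (LaurentPolynomial.T 1)) =
    Polynomial.C (mono14 c 1) := by
  have := mkHom14_T (monoUB14 c hc 1) Polynomial.X 1
  rw [zpow_one] at this
  exact this

lemma mkHom14_l (x : BB14) (l : LL14) :
    mkHom14 (monoUB14 1 one_ne_zero 1) x (Polynomial.C l) = Polynomial.C l := by
  have : ((mkHom14 (monoUB14 1 one_ne_zero 1) x : BB14 →+* BB14).comp Polynomial.C)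
      = Polynomial.C := by
    apply LL14_hom_ext
    · intro z; exact mkHom14_C _ _ z
    · have := mkHom14_T (monoUB14 1 one_ne_zero 1) x 1
      rw [zpow_one, monoUB14_val, mono14_T] at this
      exact this
  exact RingHom.congr_fun this l

def psiX14 (v w q : LL14) (h : v * w = 1) : BB14 ≃ₐ[ℂ] BB14 :=
  AlgEquiv.ofAlgHom
    (mkHom14 (monoUB14 1 one_ne_zero 1) (Polynomial.C v * Polynomial.X + Polynomial.C q))
    (mkHom14 (monoUB14 1 one_ne_zero 1) (Polynomial.C w * (Polynomial.X - Polynomial.C q)))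
    (by
      apply BB14_algHom_ext
      · simp only [AlgHom.comp_apply, mkHom14_l, AlgHom.id_apply]
      · simp only [AlgHom.comp_apply, mkHom14_X, mkHom14_l, map_mul, map_sub, AlgHom.id_apply]
        have := congrArg (Polynomial.C) h
        simp only [map_mul, map_one] at this
        linear_combination Polynomial.X * this)
    (by
      apply BB14_algHom_ext
      · simp only [AlgHom.comp_apply, mkHom14_l, AlgHom.id_apply]
      · simp only [AlgHom.comp_apply, mkHom14_X, mkHom14_l, map_mul, map_add, AlgHom.id_apply]
        have := congrArg (Polynomial.C) h
        simp only [map_mul, map_one] at this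
        linear_combination (Polynomial.X - Polynomial.C q) * this)

lemma psiX14_l (v w q : LL14) (h : v * w = 1) (l : LL14) :
    psiX14 v w q h (Polynomial.C l) = Polynomial.C l := mkHom14_l _ _

lemma psiX14_X (v w q : LL14) (h : v * w = 1) :
    psiX14 v w q h Polynomial.X = Polynomial.C v * Polynomial.X + Polynomial.C q :=
  mkHom14_X _ _

def conj14 (σ : BB14 ≃+* BB14) (ψ : BB14 ≃ₐ[ℂ] BB14) : BB14 ≃+* BB14 :=
  ψ.toRingEquiv.trans (σ.trans ψ.symm.toRingEquiv)

lemma conj14_apply (σ : BB14 ≃+* BB14) (ψ : BB14 ≃ₐ[ℂ] BB14) (b : BB14) :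
    conj14 σ ψ b = ψ.symm (σ (ψ b)) := rfl

lemma conj14_eq (σ : BB14 ≃+* BB14) (ψ : BB14 ≃ₐ[ℂ] BB14) (b b' : BB14) :
    conj14 σ ψ b = b' ↔ σ (ψ b) = ψ b' := by
  rw [conj14_apply, AlgEquiv.symm_apply_eq]

lemma conj14_anti (σ : BB14 ≃+* BB14) (ψ : BB14 ≃ₐ[ℂ] BB14) (h : Anti14 σ) :
    Anti14 (conj14 σ ψ) := by
  intro z
  rw [conj14_eq, ← algebraMap_BB14, ← algebraMap_BB14, ψ.commutes, ψ.commutes]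
  exact h z

lemma conj14_inv (σ : BB14 ≃+* BB14) (ψ : BB14 ≃ₐ[ℂ] BB14) (h : ∀ b, σ (σ b) = b) (b : BB14) :
    conj14 σ ψ (conj14 σ ψ b) = b := by
  simp [conj14_apply, h]

lemma exists_unit14 (b : ℂ) (hb : starRingEnd ℂ b * b = 1) :
    ∃ d : ℂ, d ≠ 0 ∧ starRingEnd ℂ d * b = d := by
  by_cases h : b = -1
  · exact ⟨Complex.I, Complex.I_ne_zero, by simp [h]⟩
  · refine ⟨1 + b, fun h' => h (by linear_combination h'), ?_⟩
    simp only [map_add, map_one]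
    linear_combination hb

lemma step14_T (σ : BB14 ≃+* BB14) (hσ : Anti14 σ) (hi : ∀ b, σ (σ b) = b) :
    ∃ ψ : BB14 ≃ₐ[ℂ] BB14, ∃ (n : ℤ) (ε : ℝ), ((n = 1 ∧ ε = 1) ∨ (n = -1 ∧ (ε = 1 ∨ ε = -1))) ∧
      conj14 σ ψ (Polynomial.C (LaurentPolynomial.T 1)) = Polynomial.C (mono14 ε n) := by
  obtain ⟨a, ha, n, hn, hT⟩ := auto14_T σ _ hσ
  have h1 := hi (Polynomial.C (LaurentPolynomial.T 1))
  rw [hT, resL14_spec, resL14_mono σ _ hσ ha hT, ← mono14_T] at h1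
  have h2 := (mono14_inj one_ne_zero (Polynomial.C_injective h1).symm).1.symm
  rcases hn with rfl | rfl
  · rw [zpow_one] at h2
    obtain ⟨c, hc, hca⟩ := exists_unit14 a h2
    refine ⟨psiT14 c hc, 1, 1, by simp, ?_⟩
    rw [conj14_eq, psiT14_T, resL14_spec, resL14_mono σ _ hσ ha hT, Complex.ofReal_one, mono14_T,
      psiT14_T]
    simp [hca]
  · rw [zpow_neg, zpow_one] at h2
    have h3 : starRingEnd ℂ a = a := by field_simp at h2; exact h2
    obtain ⟨r, rfl⟩ := Complex.conj_eq_iff_real.1 h3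
    have hr : r ≠ 0 := by exact_mod_cast ha
    have hc : ((√|r|)⁻¹ : ℝ) ≠ 0 := by positivity
    have hc' : (((√|r|)⁻¹ : ℝ) : ℂ) ≠ 0 := by exact_mod_cast hc
    refine ⟨psiT14 _ hc', -1, r / |r|, ?_, ?_⟩
    · right
      refine ⟨rfl, ?_⟩
      rcases lt_or_gt_of_ne hr with h | h
      · right; rw [abs_of_neg h]; field_simp
      · left; rw [abs_of_pos h]; field_simp
    · have hTi := map_T14 ((Polynomial.evalRingHom (0 : LL14)).comp (((psiT14 _ hc' : BB14 ≃+* BB14) :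
        BB14 →+* BB14).comp Polynomial.C)) hc' (n := 1) (by
          have := psiT14_T _ hc'
          simp only [RingHom.comp_apply]
          erw [this]
          simp) (-1)
      have hT' : psiT14 _ hc' (Polynomial.C (LaurentPolynomial.T (-1))) =
          Polynomial.C (mono14 ((((√|r|)⁻¹ : ℝ) : ℂ) ^ (-1 : ℤ)) (1 * (-1))) := by
        rw [← hTi]
        exact resL14_spec (psiT14 _ hc' : BB14 ≃+* BB14) _
      rw [conj14_eq, psiT14_T, resL14_spec, resL14_mono σ _ hσ ha hT,
        show mono14 ((r / |r| : ℝ) : ℂ) (-1) = LaurentPolynomial.C ((r / |r| : ℝ) : ℂ) *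
          LaurentPolynomial.T (-1) from rfl, map_mul, map_mul, hT',
        ← algebraMap_BB14, AlgEquiv.commutes, algebraMap_BB14, ← map_mul]
      congr 1
      rw [← mono14_C, mono14_mul]
      have hs : √|r| * √|r| = |r| := Real.mul_self_sqrt (abs_nonneg _)
      have hs0 : √|r| ≠ 0 := by positivity
      congr 1
      simp only [Complex.conj_ofReal, zpow_neg, zpow_one]
      norm_cast
      have hr' : |r| ≠ 0 := abs_ne_zero.2 hr
      generalize √|r| = w at hs hs0
      rw [← hs]
      field_simp

lemma step14_X (σ : BB14 ≃+* BB14) (hσ : Anti14 σ) (hi : ∀ b, σ (σ b) = b)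
    (n : ℤ) (ε : ℝ) (hnε : (n = 1 ∧ ε = 1) ∨ (n = -1 ∧ (ε = 1 ∨ ε = -1)))
    (hT : σ (Polynomial.C (LaurentPolynomial.T 1)) = Polynomial.C (mono14 ε n)) :
    ∃ ψ : BB14 ≃ₐ[ℂ] BB14, ∃ m : ℤ, (m = 0 ∨ (n = -1 ∧ ε = 1 ∧ m = 1)) ∧
      StdInv14 (conj14 σ ψ) n ε m := by
  have hε0 : (ε : ℂ) ≠ 0 := by rcases hnε with ⟨-, rfl⟩ | ⟨-, rfl | rfl⟩ <;> simp
  obtain ⟨u, p, hu, hX⟩ := auto14_X σ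
  obtain ⟨b, hb, m, rfl⟩ := unit_LL14 u hu
  set s := resL14 σ with hs
  have hi' : ∀ l, s (s l) = l := by
    intro l
    apply Polynomial.C_injective
    rw [hs, ← resL14_spec, ← resL14_spec, hi]
  have h1 := hi Polynomial.X
  rw [hX, map_add, map_mul, resL14_spec, resL14_spec, hX, ← hs] at h1
  have hA := congrArg (fun f : BB14 => f.coeff 1) h1
  have hB := congrArg (fun f : BB14 => f.coeff 0) h1
  simp [mul_add, Polynomial.coeff_C] at hA hB
  have hsm : ∀ z k, s (mono14 z k) = mono14 (starRingEnd ℂ z * ε ^ k) (n * k) := by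
    intro z k
    rw [hs, resL14_mono σ _ hσ hε0 hT]
  have hA' := hA
  rw [hsm, mono14_mul, ← mono14_one] at hA'
  obtain ⟨hA1, hA2⟩ := mono14_inj one_ne_zero hA'.symm
  -- |b| = 1 and ε ^ m = 1
  have hb2 : (ε : ℂ) ^ m = 1 ∧ starRingEnd ℂ b * b = 1 := by
    have hεm : (ε : ℂ) ^ m = 1 ∨ (ε : ℂ) ^ m = -1 := by
      rcases hnε with ⟨-, rfl⟩ | ⟨-, rfl | rfl⟩
      · simp
      · simp
      · rcases Int.even_or_odd m with h | h
        · left; simp [h.neg_one_zpow]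
        · right; simp [h.neg_one_zpow]
    rcases hεm with h | h
    · refine ⟨h, ?_⟩
      rw [h] at hA1
      linear_combination -hA1
    · exfalso
      rw [h] at hA1
      have h5 : (1 : ℂ) = - (Complex.normSq b : ℂ) := by
        rw [Complex.normSq_eq_conj_mul_self]; linear_combination hA1
      have h6 : (1 : ℝ) = - Complex.normSq b := by exact_mod_cast h5
      linarith [Complex.normSq_nonneg b]
  obtain ⟨hεm, hbb⟩ := hb2
  -- choose k and m'
  obtain ⟨k, m', hm', hkm⟩ : ∃ k m' : ℤ, (m' = 0 ∨ (n = -1 ∧ ε = 1 ∧ m' = 1)) ∧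
      n * k + m = m' + k := by
    rcases hnε with ⟨rfl, rfl⟩ | ⟨rfl, h⟩
    · exact ⟨0, 0, Or.inl rfl, by linarith⟩
    · rcases Int.even_or_odd' m with ⟨k, hk | hk⟩
      · exact ⟨k, 0, Or.inl rfl, by linarith⟩
      · refine ⟨k, 1, Or.inr ⟨rfl, ?_, rfl⟩, by linarith⟩
        rcases h with h | h
        · exact h
        · exfalso
          subst h
          have hodd : Odd m := ⟨k, hk⟩
          rw [Complex.ofReal_neg, Complex.ofReal_one, hodd.neg_one_zpow] at hεm
          norm_num at hεm
  have hεk : starRingEnd ℂ ((ε : ℂ) ^ k * b) * ((ε : ℂ) ^ k * b) = 1 := by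
    have : (ε : ℂ) * ε = 1 := by rcases hnε with ⟨-, rfl⟩ | ⟨-, rfl | rfl⟩ <;> simp
    rw [map_mul, map_zpow₀, Complex.conj_ofReal]
    have h2 : (ε : ℂ) ^ k * (ε : ℂ) ^ k = 1 := by rw [← mul_zpow, this, one_zpow]
    linear_combination (starRingEnd ℂ b * b) * h2 + hbb
  obtain ⟨d, hd, hdb⟩ := exists_unit14 _ hεk
  set v := mono14 d k with hv
  set u := mono14 b m with hu'
  set hf : LL14 := LaurentPolynomial.C (1 / 2) with hhf
  have hf2 : 2 * hf = 1 := by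
    have : (2 : LL14) = LaurentPolynomial.C 2 := (map_ofNat LaurentPolynomial.C 2).symm
    rw [this, hhf, ← map_mul]; norm_num
  have hsf : s hf = hf := by
    rw [hhf, hs, resL14_C σ _ hσ, map_div₀, map_one, map_ofNat]
  have hsv : s v * u = LaurentPolynomial.T m' * v := by
    rw [hv, hsm, hu', mono14_mul, ← mono14_T, mono14_mul]
    congr 1
    linear_combination hdb
  refine ⟨psiX14 v (mono14 d⁻¹ (-k)) (v * s u * p * hf) (mono14_unit hd k), m', hm', ?_, ?_⟩
  · rw [conj14_eq, psiX14_l, psiX14_l, hT]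
  · rw [conj14_eq, map_mul, psiX14_l, psiX14_X, map_add, map_mul, resL14_spec, resL14_spec, hX, ← hs,
      map_mul s, map_mul s, map_mul s, hi', hsf]
    have g1 : s v * p + s v * u * s p * hf = LaurentPolynomial.T m' * (v * s u * p * hf) := by
      linear_combination (s v * u * hf) * hB + (s u * p * hf) * hsv - (2 * s v * p * hf) * hA
        - s v * p * hf2
    have G1 := congrArg Polynomial.C g1
    have G2 := congrArg Polynomial.C hsv
    simp only [map_mul, map_add] at G1 G2 ⊢
    linear_combination G1 + Polynomial.X * G2

lemma classify14 (σ : BB14 ≃+* BB14) (hσ : Anti14 σ) (hi : ∀ b, σ (σ b) = b) :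
    ∃ ψ : BB14 ≃ₐ[ℂ] BB14, StdInv14 (conj14 σ ψ) 1 1 0 ∨ StdInv14 (conj14 σ ψ) (-1) 1 0 ∨
      StdInv14 (conj14 σ ψ) (-1) (-1) 0 ∨ StdInv14 (conj14 σ ψ) (-1) 1 1 := by
  obtain ⟨ψ, n, ε, h, hT⟩ := step14_T σ hσ hi
  obtain ⟨χ, m, hm, hS⟩ := step14_X (conj14 σ ψ) (conj14_anti σ ψ hσ) (conj14_inv σ ψ hi) n ε h hT
  have : conj14 (conj14 σ ψ) χ = conj14 σ (χ.trans ψ) := rfl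
  rw [this] at hS
  refine ⟨χ.trans ψ, ?_⟩
  rcases h with ⟨rfl, rfl⟩ | ⟨rfl, rfl | rfl⟩ <;> rcases hm with rfl | ⟨h1, h2, rfl⟩
  · exact Or.inl hS
  · norm_num at h1
  · exact Or.inr (Or.inl hS)
  · exact Or.inr (Or.inr (Or.inr hS))
  · exact Or.inr (Or.inr (Or.inl hS))
  · norm_num at h2

end RF14c

noncomputable section RF14d

section
variable (A : Type) [CommRing A] [Algebra ℝ A]

def kap14 : (ℂ ⊗[ℝ] A) ≃ₐ[ℝ] (ℂ ⊗[ℝ] A) :=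
  Algebra.TensorProduct.congr Complex.conjAe AlgEquiv.refl

variable {A}

lemma kap14_tmul (z : ℂ) (a : A) : kap14 A (z ⊗ₜ a) = (starRingEnd ℂ z) ⊗ₜ a := rfl

lemma kap14_kap (x : ℂ ⊗[ℝ] A) : kap14 A (kap14 A x) = x := by
  induction x using TensorProduct.induction_on with
  | zero => simp
  | tmul z a => simp [kap14_tmul]
  | add x y hx hy => rw [map_add, map_add, hx, hy]

lemma kap14_decomp (x : ℂ ⊗[ℝ] A) : ∃ a b : A, x = 1 ⊗ₜ a + Complex.I ⊗ₜ b := by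
  induction x using TensorProduct.induction_on with
  | zero => exact ⟨0, 0, by simp⟩
  | tmul z a =>
    refine ⟨z.re • a, z.im • a, ?_⟩
    rw [← TensorProduct.smul_tmul, ← TensorProduct.smul_tmul, ← TensorProduct.add_tmul]
    congr 1
    apply Complex.ext <;> simp
  | add x y hx hy =>
    obtain ⟨a, b, rfl⟩ := hx
    obtain ⟨c, d, rfl⟩ := hy
    refine ⟨a + c, b + d, ?_⟩
    simp only [TensorProduct.tmul_add]; abel

lemma kap14_fixed (x : ℂ ⊗[ℝ] A) (h : kap14 A x = x) : ∃ a : A, x = 1 ⊗ₜ a := by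
  obtain ⟨a, b, rfl⟩ := kap14_decomp x
  refine ⟨a, ?_⟩
  rw [map_add, kap14_tmul, kap14_tmul, map_one, Complex.conj_I, TensorProduct.neg_tmul] at h
  have h1 : (2 : ℝ) • (Complex.I ⊗ₜ[ℝ] b) = 0 := by
    rw [two_smul]
    nth_rewrite 1 [← add_left_cancel h]
    simp
  have h2 := (smul_eq_zero_iff_right (two_ne_zero)).1 h1
  rw [h2, add_zero]

lemma incl14_inj : Function.Injective
    (Algebra.TensorProduct.includeRight : A →ₐ[ℝ] ℂ ⊗[ℝ] A) :=
  Algebra.TensorProduct.includeRight_injective (algebraMap ℝ ℂ).injective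

lemma iso14_of_kap {A' : Type} [CommRing A'] [Algebra ℝ A']
    (φ : (ℂ ⊗[ℝ] A) ≃ₐ[ℂ] (ℂ ⊗[ℝ] A')) (h : ∀ x, φ (kap14 A x) = kap14 A' (φ x)) :
    Nonempty (A ≃ₐ[ℝ] A') := by
  let i' : A' →ₐ[ℝ] ℂ ⊗[ℝ] A' := Algebra.TensorProduct.includeRight
  let i : A →ₐ[ℝ] ℂ ⊗[ℝ] A := Algebra.TensorProduct.includeRight
  let j : A' ≃ₐ[ℝ] i'.range := AlgEquiv.ofInjective i' incl14_inj
  let g : A →ₐ[ℝ] ℂ ⊗[ℝ] A' := ((φ : _ →ₐ[ℂ] _).restrictScalars ℝ).comp i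
  have hg : ∀ a, g a ∈ i'.range := by
    intro a
    have : kap14 A' (g a) = g a := by
      have h1 : g a = φ (1 ⊗ₜ a) := rfl
      rw [h1, ← h, kap14_tmul, map_one]
    obtain ⟨b, hb⟩ := kap14_fixed _ this
    exact ⟨b, hb.symm⟩
  let k : A →ₐ[ℝ] A' := (j.symm : i'.range →ₐ[ℝ] A').comp (g.codRestrict i'.range hg)
  have hk : ∀ a, i' (k a) = g a := by
    intro a
    have : (j (k a) : ℂ ⊗[ℝ] A') = g a := by
      simp [k]
    exact this
  refine ⟨AlgEquiv.ofBijective k ⟨?_, ?_⟩⟩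
  · intro a b hab
    apply incl14_inj
    apply φ.injective
    have := congrArg i' hab
    rw [hk, hk] at this
    exact this
  · intro a'
    have h1 : kap14 A (φ.symm (1 ⊗ₜ a')) = φ.symm (1 ⊗ₜ a') := by
      apply φ.injective
      rw [h, φ.apply_symm_apply, kap14_tmul, map_one]
    obtain ⟨a, ha⟩ := kap14_fixed _ h1
    refine ⟨a, ?_⟩
    apply incl14_inj
    have h2 := hk a
    have h3 : g a = φ (1 ⊗ₜ a) := rfl
    rw [h3, ← ha, φ.apply_symm_apply] at h2
    exact h2

def sig14 (e : (ℂ ⊗[ℝ] A) ≃ₐ[ℂ] BB14) : BB14 ≃+* BB14 :=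
  e.symm.toRingEquiv.trans ((kap14 A).toRingEquiv.trans e.toRingEquiv)

lemma sig14_apply (e : (ℂ ⊗[ℝ] A) ≃ₐ[ℂ] BB14) (b : BB14) :
    sig14 e b = e (kap14 A (e.symm b)) := rfl

lemma sig14_anti (e : (ℂ ⊗[ℝ] A) ≃ₐ[ℂ] BB14) : Anti14 (sig14 e) := by
  intro z
  rw [sig14_apply, ← algebraMap_BB14, e.symm.commutes, Algebra.TensorProduct.algebraMap_apply,
    kap14_tmul, ← algebraMap_BB14, ← e.commutes]
  rfl

lemma sig14_inv (e : (ℂ ⊗[ℝ] A) ≃ₐ[ℂ] BB14) (b : BB14) : sig14 e (sig14 e b) = b := by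
  simp [sig14_apply, kap14_kap]

variable (A) in
def Std14 (n : ℤ) (ε : ℝ) (m : ℤ) : Prop :=
  ∃ e : (ℂ ⊗[ℝ] A) ≃ₐ[ℂ] BB14, StdInv14 (sig14 e) n ε m

lemma std14_iso {A' : Type} [CommRing A'] [Algebra ℝ A'] {n : ℤ} {ε : ℝ} {m : ℤ}
    (h : Std14 A n ε m) (h' : Std14 A' n ε m) : Nonempty (A ≃ₐ[ℝ] A') := by
  obtain ⟨e, he⟩ := h
  obtain ⟨e', he'⟩ := h'
  have hs : (sig14 e : BB14 →+* BB14) = sig14 e' := by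
    apply BB14_hom_ext
    · intro z
      exact (sig14_anti e z).trans (sig14_anti e' z).symm
    · exact he.1.trans he'.1.symm
    · exact he.2.trans he'.2.symm
  apply iso14_of_kap (e.trans e'.symm)
  intro x
  have := RingHom.congr_fun hs (e x)
  have h2 : e (kap14 A x) = e' (kap14 A' (e'.symm (e x))) := by
    have h3 : sig14 e (e x) = sig14 e' (e x) := this
    rw [sig14_apply, sig14_apply, e.symm_apply_apply] at h3
    exact h3
  simp only [AlgEquiv.trans_apply]
  rw [h2, e'.symm_apply_apply]

lemma std14_not_iso {A' : Type} [CommRing A'] [Algebra ℝ A'] {n n' : ℤ} {ε ε' : ℝ} {m m' : ℤ}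
    (h : Std14 A n ε m) (h' : Std14 A' n' ε' m')
    (hε : ε = 1 ∨ ε = -1) (hε' : ε' = 1 ∨ ε' = -1)
    (hne : ¬ (n = n' ∧ (n = -1 → ε = ε' ∧ Even (m - m')))) : NotIso14 A A' := by
  refine ⟨fun i => hne ?_⟩
  obtain ⟨e, he⟩ := h
  obtain ⟨e', he'⟩ := h'
  let I : (ℂ ⊗[ℝ] A) ≃ₐ[ℂ] (ℂ ⊗[ℝ] A') := Algebra.TensorProduct.congr AlgEquiv.refl i
  have hI : ∀ x, I (kap14 A x) = kap14 A' (I x) := by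
    intro x
    induction x using TensorProduct.induction_on with
    | zero => simp
    | tmul z a => rfl
    | add x y hx hy => simp only [map_add, hx, hy]
  let ψ : BB14 ≃ₐ[ℂ] BB14 := e.symm.trans (I.trans e')
  refine std14_unique (sig14 e) (sig14 e') ψ.toRingEquiv (sig14_anti e') ?_ ?_ n n' ε ε' m m'
    hε hε' he he'
  · intro z
    exact ψ.commutes z
  · intro b
    change e' (I (e.symm (e (kap14 A (e.symm b))))) = e' (kap14 A' (e'.symm (e' (I (e.symm b)))))
    rw [e.symm_apply_apply, e'.symm_apply_apply, hI]

lemma std14_classify (e : (ℂ ⊗[ℝ] A) ≃ₐ[ℂ] BB14) :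
    Std14 A 1 1 0 ∨ Std14 A (-1) 1 0 ∨ Std14 A (-1) (-1) 0 ∨ Std14 A (-1) 1 1 := by
  obtain ⟨ψ, h⟩ := classify14 (sig14 e) (sig14_anti e) (sig14_inv e)
  have : conj14 (sig14 e) ψ = sig14 (e.trans ψ.symm) := rfl
  rw [this] at h
  rcases h with h | h | h | h
  · exact Or.inl ⟨_, h⟩
  · exact Or.inr (Or.inl ⟨_, h⟩)
  · exact Or.inr (Or.inr (Or.inl ⟨_, h⟩))
  · exact Or.inr (Or.inr (Or.inr ⟨_, h⟩))

def lift14 (f : A →ₐ[ℝ] BB14) : (ℂ ⊗[ℝ] A) →ₐ[ℂ] BB14 :=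
  Algebra.TensorProduct.lift (Algebra.ofId ℂ BB14) f (fun _ _ => Commute.all _ _)

lemma lift14_tmul (f : A →ₐ[ℝ] BB14) (z : ℂ) (a : A) :
    lift14 f (z ⊗ₜ a) = Polynomial.C (LaurentPolynomial.C z) * f a := by
  simp [lift14, Algebra.ofId_apply, algebraMap_BB14]

lemma std14_of_gens (τ x y : A)
    (hext : ∀ f g : A →ₐ[ℝ] ℂ ⊗[ℝ] A, f τ = g τ → f x = g x → f y = g y → f = g)
    (c1 c2 d1 d2 a1 a2 b1 b2 : ℂ)
    (e1 : c1 * a1 + c2 * b1 = 1) (e2 : c1 * a2 + c2 * b2 = 0)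
    (e3 : a1 * c1 + a2 * d1 = 1) (e4 : a1 * c2 + a2 * d2 = 0)
    (e5 : b1 * c1 + b2 * d1 = 0) (e6 : b1 * c2 + b2 * d2 = 1)
    (e7 : d1 * a1 + d2 * b1 = 0) (e8 : d1 * a2 + d2 * b2 = 1)
    (ht : (c1 ⊗ₜ[ℝ] x + c2 ⊗ₜ[ℝ] y) * (d1 ⊗ₜ[ℝ] x + d2 ⊗ₜ[ℝ] y) = 1)
    (f : A →ₐ[ℝ] BB14) (fτ : f τ = Polynomial.X)
    (fx : f x = Polynomial.C (mono14 a1 1 + mono14 a2 (-1)))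
    (fy : f y = Polynomial.C (mono14 b1 1 + mono14 b2 (-1)))
    (n : ℤ) (ε : ℝ)
    (hκ : (n = 1 ∧ starRingEnd ℂ c1 = ε * c1 ∧ starRingEnd ℂ c2 = ε * c2) ∨
      (n = -1 ∧ starRingEnd ℂ c1 = ε * d1 ∧ starRingEnd ℂ c2 = ε * d2)) :
    Std14 A n ε 0 := by
  let t : (ℂ ⊗[ℝ] A)ˣ := ⟨_, _, ht, by rw [mul_comm]; exact ht⟩
  have ht1 : (t : ℂ ⊗[ℝ] A) = c1 ⊗ₜ[ℝ] x + c2 ⊗ₜ[ℝ] y := rfl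
  have ht2 : ((t⁻¹ : (ℂ ⊗[ℝ] A)ˣ) : ℂ ⊗[ℝ] A) = d1 ⊗ₜ[ℝ] x + d2 ⊗ₜ[ℝ] y := rfl
  let G : BB14 →ₐ[ℂ] ℂ ⊗[ℝ] A := mkHom14 t (1 ⊗ₜ τ)
  have hlin : ∀ r s u v : ℂ, (Polynomial.C (LaurentPolynomial.C r) *
      Polynomial.C (mono14 a1 1 + mono14 a2 (-1)) + Polynomial.C (LaurentPolynomial.C s) *
      Polynomial.C (mono14 b1 1 + mono14 b2 (-1)) : BB14) =
      Polynomial.C (mono14 (r * a1 + s * b1) 1 + mono14 (r * a2 + s * b2) (-1)) := by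
    intro r s u v
    rw [← map_mul, ← map_mul, ← map_add]
    congr 1
    simp only [mono14, map_add, map_mul]
    ring
  have hG : ∀ z w : ℂ, G (Polynomial.C (mono14 z 1 + mono14 w (-1))) =
      (z * c1 + w * d1) ⊗ₜ x + (z * c2 + w * d2) ⊗ₜ y := by
    intro z w
    simp only [mono14, map_add, map_mul]
    simp only [G, mkHom14_C, mkHom14_T, zpow_one, zpow_neg, ht1, ht2,
      Algebra.TensorProduct.algebraMap_apply, Algebra.algebraMap_self, RingHom.id_apply, mul_add,
      Algebra.TensorProduct.tmul_mul_tmul, one_mul, TensorProduct.add_tmul]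
    abel
  have h0 : ∀ k, mono14 0 k = 0 := by intro k; simp [mono14]
  have hFG : (lift14 f).comp G = AlgHom.id ℂ BB14 := by
    apply BB14_algHom_ext
    · simp only [AlgHom.comp_apply, G, mkHom14_T, zpow_one, ht1, map_add, lift14_tmul, fx, fy,
        AlgHom.id_apply]
      rw [← map_add, ← map_add, hlin _ _ 0 0, e1, e2, h0, add_zero, mono14_T]
    · simp only [AlgHom.comp_apply, G, mkHom14_X, lift14_tmul, fτ, map_one, one_mul,
        AlgHom.id_apply]
  have hGF : G.comp (lift14 f) = AlgHom.id ℂ (ℂ ⊗[ℝ] A) := by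
    apply Algebra.TensorProduct.ext (by ext)
    apply hext
    · simp [lift14_tmul, fτ, G, mkHom14_X]
    · simp only [AlgHom.comp_apply, AlgHom.restrictScalars_apply,
        Algebra.TensorProduct.includeRight_apply, lift14_tmul, map_one, one_mul, fx, hG, e3, e4]
      simp
    · simp only [AlgHom.comp_apply, AlgHom.restrictScalars_apply,
        Algebra.TensorProduct.includeRight_apply, lift14_tmul, map_one, one_mul, fy, hG, e5, e6]
      simp
  let e : (ℂ ⊗[ℝ] A) ≃ₐ[ℂ] BB14 := AlgEquiv.ofAlgHom (lift14 f) G hFG hGF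
  refine ⟨e, ?_, ?_⟩
  · have h1 : e.symm (Polynomial.C (LaurentPolynomial.T 1)) = c1 ⊗ₜ[ℝ] x + c2 ⊗ₜ[ℝ] y := by
      have := mkHom14_T t (1 ⊗ₜ τ) 1
      rw [zpow_one] at this
      exact this
    rw [sig14_apply, h1, map_add, kap14_tmul, kap14_tmul]
    have h2 : ∀ q, e q = lift14 f q := fun _ => rfl
    rw [h2, map_add, lift14_tmul, lift14_tmul, fx, fy, hlin _ _ 0 0]
    rcases hκ with ⟨rfl, k1, k2⟩ | ⟨rfl, k1, k2⟩ <;> rw [k1, k2]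
    · rw [show ε * c1 * a1 + ε * c2 * b1 = ε by linear_combination ε * e1,
        show ε * c1 * a2 + ε * c2 * b2 = 0 by linear_combination ε * e2, h0, add_zero]
    · rw [show ε * d1 * a1 + ε * d2 * b1 = 0 by linear_combination ε * e7,
        show ε * d1 * a2 + ε * d2 * b2 = ε by linear_combination ε * e8, h0, zero_add]
  · have h1 : e.symm Polynomial.X = 1 ⊗ₜ τ := mkHom14_X _ _
    have h2 : ∀ q, e q = lift14 f q := fun _ => rfl
    rw [sig14_apply, h1, kap14_tmul, h2, lift14_tmul, fτ]
    simp

lemma std14_of_inj (f : A →ₐ[ℝ] BB14) (hf : Function.Injective f) (σ : BB14 →+* BB14)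
    (hσ : ∀ z : ℂ, σ (Polynomial.C (LaurentPolynomial.C z)) =
      Polynomial.C (LaurentPolynomial.C (starRingEnd ℂ z)))
    (hfix : ∀ a, σ (f a) = f a) (t t' x : ℂ ⊗[ℝ] A)
    (h1 : lift14 f t = Polynomial.C (LaurentPolynomial.T 1))
    (h2 : lift14 f t' = Polynomial.C (LaurentPolynomial.T (-1)))
    (h3 : lift14 f x = Polynomial.X)
    (n : ℤ) (ε : ℝ) (m : ℤ)
    (hT : σ (Polynomial.C (LaurentPolynomial.T 1)) = Polynomial.C (mono14 ε n))
    (hX : σ Polynomial.X = Polynomial.C (LaurentPolynomial.T m) * Polynomial.X) :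
    Std14 A n ε m := by
  have hκ : ∀ q, lift14 f (kap14 A q) = σ (lift14 f q) := by
    intro q
    induction q using TensorProduct.induction_on with
    | zero => simp
    | tmul z a => rw [kap14_tmul, lift14_tmul, lift14_tmul, map_mul, hσ, hfix]
    | add x y hx hy => simp only [map_add, hx, hy]
  have hinj : Function.Injective (lift14 f) := by
    rw [injective_iff_map_eq_zero]
    intro q hq
    have hq' := hκ q
    rw [hq, map_zero] at hq'
    obtain ⟨a, b, rfl⟩ := kap14_decomp q
    rw [map_add, kap14_tmul, kap14_tmul, map_one, Complex.conj_I, map_add, lift14_tmul,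
      lift14_tmul] at hq'
    rw [map_add, lift14_tmul, lift14_tmul] at hq
    simp only [map_one, one_mul, map_neg, neg_mul] at hq hq'
    have ha : f a = 0 := by
      have : (2 : ℝ) • f a = 0 := by rw [two_smul]; linear_combination hq + hq'
      exact (smul_eq_zero_iff_right (two_ne_zero)).1 this
    have hb : f b = 0 := by
      rw [ha, zero_add] at hq
      rcases mul_eq_zero.1 hq with h | h
      · exfalso
        have h5 : (algebraMap ℂ BB14) Complex.I = 0 := h
        exact Complex.I_ne_zero ((map_eq_zero _).1 h5)
      · exact h
    rw [(injective_iff_map_eq_zero f).1 hf a ha, (injective_iff_map_eq_zero f).1 hf b hb]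
    simp
  have htt : t * t' = 1 := by
    apply hinj
    rw [map_mul, h1, h2, ← map_mul, ← LaurentPolynomial.T_add]
    simp
  let tu : (ℂ ⊗[ℝ] A)ˣ := ⟨t, t', htt, by rw [mul_comm]; exact htt⟩
  have hFG : (lift14 f).comp (mkHom14 tu x) = AlgHom.id ℂ BB14 := by
    apply BB14_algHom_ext
    · simp only [AlgHom.comp_apply, mkHom14_T, zpow_one, AlgHom.id_apply]
      exact h1
    · simp only [AlgHom.comp_apply, mkHom14_X, AlgHom.id_apply]
      exact h3
  let e : (ℂ ⊗[ℝ] A) ≃ₐ[ℂ] BB14 := AlgEquiv.ofBijective (lift14 f)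
    ⟨hinj, fun b => ⟨mkHom14 tu x b, AlgHom.congr_fun hFG b⟩⟩
  have hs : ∀ b, sig14 e b = σ b := by
    intro b
    have : e (kap14 A (e.symm b)) = σ (e (e.symm b)) := hκ _
    rw [e.apply_symm_apply] at this
    exact this
  exact ⟨e, by rw [hs, hT], by rw [hs, hX]⟩

end

end RF14d

noncomputable section RF14e

def TU14 (R : Type*) [CommRing R] (n : ℤ) : (LaurentPolynomial R)ˣ :=
  ⟨LaurentPolynomial.T n, LaurentPolynomial.T (-n),
    by rw [← LaurentPolynomial.T_add]; simp, by rw [← LaurentPolynomial.T_add]; simp⟩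

lemma TU14_zpow (R : Type*) [CommRing R] (n : ℤ) :
    ((TU14 R 1 ^ n : (LaurentPolynomial R)ˣ) : LaurentPolynomial R) = LaurentPolynomial.T n := by
  induction n using Int.induction_on with
  | zero => simp
  | succ i ih =>
    rw [zpow_add_one, Units.val_mul, ih, LaurentPolynomial.T_add]; rfl
  | pred i ih =>
    rw [zpow_sub_one, Units.val_mul, ih, LaurentPolynomial.T_sub]; rfl

def toBB14 : LaurentPolynomial (Polynomial ℂ) →ₐ[ℂ] BB14 :=
  { LaurentPolynomial.eval₂ (Polynomial.eval₂RingHom (algebraMap ℂ BB14) Polynomial.X)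
      (monoUB14 1 one_ne_zero 1) with
    commutes' := by
      intro z
      have : algebraMap ℂ (LaurentPolynomial (Polynomial ℂ)) z =
        LaurentPolynomial.C (Polynomial.C z) := rfl
      rw [this]
      simp }

lemma toBB14_C (p : Polynomial ℂ) : toBB14 (LaurentPolynomial.C p) =
    Polynomial.eval₂ (algebraMap ℂ BB14) Polynomial.X p := by
  simp [toBB14]

lemma toBB14_T (n : ℤ) : toBB14 (LaurentPolynomial.T n) =
    Polynomial.C (LaurentPolynomial.T n) := by
  have : toBB14 (LaurentPolynomial.T n) = ((monoUB14 1 one_ne_zero 1 ^ n : BB14ˣ) : BB14) := by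
    simp [toBB14]
  rw [this, monoUB14, ← map_zpow]
  change Polynomial.C ((monoU14 1 one_ne_zero 1 ^ n : LL14ˣ) : LL14) = _
  rw [monoU14_zpow]
  simp [mono14]

def isoB14 : LaurentPolynomial (Polynomial ℂ) ≃ₐ[ℂ] BB14 :=
  AlgEquiv.ofAlgHom toBB14 (mkHom14 (TU14 _ 1) (LaurentPolynomial.C Polynomial.X))
    (by
      apply BB14_algHom_ext
      · simp only [AlgHom.comp_apply, mkHom14_T, TU14_zpow, toBB14_T, AlgHom.id_apply]
      · simp only [AlgHom.comp_apply, mkHom14_X, toBB14_C, AlgHom.id_apply, Polynomial.eval₂_X])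
    (by
      have hC : ∀ p : Polynomial ℂ, mkHom14 (TU14 _ 1) (LaurentPolynomial.C Polynomial.X)
          (toBB14 (LaurentPolynomial.C p)) = LaurentPolynomial.C p := by
        intro p
        rw [toBB14_C]
        induction p using Polynomial.induction_on' with
        | add p q hp hq => rw [Polynomial.eval₂_add, map_add, hp, hq, map_add]
        | monomial n a =>
          rw [← Polynomial.C_mul_X_pow_eq_monomial]
          simp only [Polynomial.eval₂_mul, Polynomial.eval₂_C, Polynomial.eval₂_X_pow, map_mul,
            map_pow, mkHom14_X, AlgHom.commutes]
          rfl
      refine AlgHom.ext fun q => ?_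
      induction q using LaurentPolynomial.induction_on' with
      | add p q hp hq => rw [map_add, map_add, hp, hq]
      | C_mul_T n a =>
        rw [AlgHom.comp_apply, map_mul, map_mul, hC, toBB14_T, mkHom14_T, TU14_zpow]
        rfl)

section
variable (i : Fin 3)

lemma gam14_ext {R : Type} [CommRing R] [Algebra ℝ R]
    (f g : Polynomial ℝ ⊗[ℝ] Gamma14 i →ₐ[ℝ] R)
    (h1 : f (Polynomial.X ⊗ₜ 1) = g (Polynomial.X ⊗ₜ 1))
    (h2 : f (1 ⊗ₜ Ideal.Quotient.mk _ (X 0)) = g (1 ⊗ₜ Ideal.Quotient.mk _ (X 0)))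
    (h3 : f (1 ⊗ₜ Ideal.Quotient.mk _ (X 1)) = g (1 ⊗ₜ Ideal.Quotient.mk _ (X 1))) : f = g := by
  apply Algebra.TensorProduct.ext
  · apply Polynomial.algHom_ext
    exact h1
  · apply Ideal.Quotient.algHom_ext
    apply MvPolynomial.algHom_ext
    intro j
    fin_cases j
    · exact h2
    · exact h3

def gam14_map (α β : BB14) (h : aeval ![α, β] (conic14 i) = 0) :
    Polynomial ℝ ⊗[ℝ] Gamma14 i →ₐ[ℝ] BB14 :=
  Algebra.TensorProduct.lift (Polynomial.aeval Polynomial.X)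
    (Ideal.Quotient.liftₐ _ (aeval ![α, β]) (by
      intro a ha
      obtain ⟨b, rfl⟩ := Ideal.mem_span_singleton'.1 ha
      rw [map_mul, h, mul_zero])) (fun _ _ => Commute.all _ _)

lemma gam14_map_t (α β : BB14) (h : aeval ![α, β] (conic14 i) = 0) :
    gam14_map i α β h (Polynomial.X ⊗ₜ 1) = Polynomial.X := by
  simp [gam14_map]

lemma gam14_map_x (α β : BB14) (h : aeval ![α, β] (conic14 i) = 0) (j : Fin 2) :
    gam14_map i α β h (1 ⊗ₜ Ideal.Quotient.mk _ (X j)) = ![α, β] j := by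
  rw [gam14_map, Algebra.TensorProduct.lift_tmul, map_one, one_mul]
  erw [Ideal.Quotient.liftₐ_apply, Ideal.Quotient.lift_mk]
  simp

end

lemma gam14_rel (i : Fin 3) : (Ideal.Quotient.mk (Ideal.span {conic14 i}) (conic14 i)) = 0 :=
  Ideal.Quotient.eq_zero_iff_mem.2 (Ideal.mem_span_singleton_self _)

lemma tens14 {A : Type} [CommRing A] [Algebra ℝ A] (c1 c2 d1 d2 : ℂ) (x y : A) :
    (c1 ⊗ₜ[ℝ] x + c2 ⊗ₜ[ℝ] y) * (d1 ⊗ₜ[ℝ] x + d2 ⊗ₜ[ℝ] y) =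
    (c1 * d1) ⊗ₜ[ℝ] (x ^ 2) + (c1 * d2 + c2 * d1) ⊗ₜ[ℝ] (x * y) + (c2 * d2) ⊗ₜ[ℝ] (y ^ 2) := by
  simp only [mul_add, add_mul, Algebra.TensorProduct.tmul_mul_tmul,
    TensorProduct.add_tmul, sq, mul_comm y x]
  abel

def HT14 {A : Type} [CommRing A] [Algebra ℝ A] (x y : A) (c1 c2 d1 d2 : ℂ) : Prop :=
  (c1 ⊗ₜ[ℝ] x + c2 ⊗ₜ[ℝ] y) * (d1 ⊗ₜ[ℝ] x + d2 ⊗ₜ[ℝ] y) = 1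

section
variable {A : Type} [CommRing A] [Algebra ℝ A] (φ : MvPolynomial (Fin 2) ℝ →+* A)

lemma tens14_0 (h : φ (X 0 * X 1 - 1) = 0) : HT14 (φ (X 0)) (φ (X 1)) 1 0 0 1 := by
  rw [map_sub, map_mul, map_one, sub_eq_zero] at h
  rw [HT14, tens14, h]; simp [Algebra.TensorProduct.one_def]

lemma tens14_1 (h : φ (X 0 ^ 2 + X 1 ^ 2 - 1) = 0) :
    HT14 (φ (X 0)) (φ (X 1)) 1 Complex.I 1 (-Complex.I) := by
  rw [map_sub, map_add, map_pow, map_pow, map_one, sub_eq_zero] at h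
  rw [HT14, tens14, show (1 : ℂ) * -Complex.I + Complex.I * 1 = 0 by ring,
      show Complex.I * -Complex.I = 1 by linear_combination -Complex.I_mul_I, mul_one,
      TensorProduct.zero_tmul, add_zero, ← TensorProduct.tmul_add, h]
  rfl

lemma tens14_2 (h : φ (X 0 ^ 2 + X 1 ^ 2 + 1) = 0) :
    HT14 (φ (X 0)) (φ (X 1)) 1 Complex.I (-1) Complex.I := by
  rw [map_add, map_add, map_pow, map_pow, map_one] at h
  rw [HT14, tens14, show (1 : ℂ) * Complex.I + Complex.I * -1 = 0 by ring,
      show Complex.I * Complex.I = 1 * -1 by linear_combination Complex.I_mul_I,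
      TensorProduct.zero_tmul, add_zero, ← TensorProduct.tmul_add,
      eq_neg_of_add_eq_zero_left h, one_mul,
      TensorProduct.tmul_neg, TensorProduct.neg_tmul, neg_neg]
  rfl
end

def gxh14 (i : Fin 3) : MvPolynomial (Fin 2) ℝ →+* Polynomial ℝ ⊗[ℝ] Gamma14 i :=
  (Algebra.TensorProduct.includeRight : Gamma14 i →ₐ[ℝ] Polynomial ℝ ⊗[ℝ] Gamma14 i).toRingHom.comp
    (Ideal.Quotient.mk _)

lemma gxh14_rel (i : Fin 3) : gxh14 i (conic14 i) = 0 := by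
  rw [gxh14, RingHom.comp_apply, gam14_rel, map_zero]

lemma std14_gam (i : Fin 3) (c1 c2 d1 d2 a1 a2 b1 b2 : ℂ)
    (e1 : c1 * a1 + c2 * b1 = 1) (e2 : c1 * a2 + c2 * b2 = 0)
    (e3 : a1 * c1 + a2 * d1 = 1) (e4 : a1 * c2 + a2 * d2 = 0)
    (e5 : b1 * c1 + b2 * d1 = 0) (e6 : b1 * c2 + b2 * d2 = 1)
    (e7 : d1 * a1 + d2 * b1 = 0) (e8 : d1 * a2 + d2 * b2 = 1)
    (ht : HT14 (gxh14 i (X 0)) (gxh14 i (X 1)) c1 c2 d1 d2)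
    (h : aeval ![(Polynomial.C (mono14 a1 1 + mono14 a2 (-1)) : BB14),
      Polynomial.C (mono14 b1 1 + mono14 b2 (-1))] (conic14 i) = 0)
    (n : ℤ) (ε : ℝ)
    (hκ : (n = 1 ∧ starRingEnd ℂ c1 = ε * c1 ∧ starRingEnd ℂ c2 = ε * c2) ∨
      (n = -1 ∧ starRingEnd ℂ c1 = ε * d1 ∧ starRingEnd ℂ c2 = ε * d2)) :
    Std14 (Polynomial ℝ ⊗[ℝ] Gamma14 i) n ε 0 :=
  std14_of_gens (Polynomial.X ⊗ₜ 1) (gxh14 i (X 0)) (gxh14 i (X 1))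
    (gam14_ext i) c1 c2 d1 d2 a1 a2 b1 b2 e1 e2 e3 e4 e5 e6 e7 e8
    ht (gam14_map i _ _ h) (gam14_map_t i _ _ h) (gam14_map_x i _ _ h 0) (gam14_map_x i _ _ h 1)
    n ε hκ

lemma std14_gam0 : Std14 (Polynomial ℝ ⊗[ℝ] Gamma14 0) 1 1 0 := by
  refine std14_gam 0 1 0 0 1 1 0 0 1 (by simp) (by simp) (by simp) (by simp) (by simp) (by simp)
    (by simp) (by simp) (tens14_0 _ (gxh14_rel 0)) ?_ 1 1 (Or.inl (by simp))
  change aeval _ (X 0 * X 1 - 1 : MvPolynomial (Fin 2) ℝ) = 0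
  rw [map_sub, map_mul, map_one, aeval_X, aeval_X, sub_eq_zero]
  change Polynomial.C _ * Polynomial.C _ = 1
  rw [← map_mul, ← map_one Polynomial.C]
  congr 1
  simp only [mono14, map_zero, zero_mul, add_zero, zero_add, map_one, one_mul]
  rw [← LaurentPolynomial.T_add]
  simp

lemma mono14_eval (a : ℂ) : mono14 a 1 = LaurentPolynomial.C a * LaurentPolynomial.T 1 := rfl

lemma LL14_id (a1 a2 b1 b2 c : ℂ) (h1 : a1 * a1 + b1 * b1 = 0) (h2 : a2 * a2 + b2 * b2 = 0)
    (h3 : 2 * (a1 * a2 + b1 * b2) = c) :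
    (mono14 a1 1 + mono14 a2 (-1)) ^ 2 + (mono14 b1 1 + mono14 b2 (-1)) ^ 2 =
      LaurentPolynomial.C c := by
  have hT : (LaurentPolynomial.T 1 : LL14) * LaurentPolynomial.T (-1) = 1 := by
    rw [← LaurentPolynomial.T_add]; simp
  have h1 := congrArg (LaurentPolynomial.C : ℂ →+* LL14) h1
  have h2 := congrArg (LaurentPolynomial.C : ℂ →+* LL14) h2
  have h3 := congrArg (LaurentPolynomial.C : ℂ →+* LL14) h3
  simp only [map_add, map_mul, map_zero, map_ofNat] at h1 h2 h3
  simp only [mono14]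
  rw [← h3]
  linear_combination (LaurentPolynomial.T 1 : LL14) ^ 2 * h1 +
    (LaurentPolynomial.T (-1) : LL14) ^ 2 * h2 +
    2 * (LaurentPolynomial.C a1 * LaurentPolynomial.C a2 +
      LaurentPolynomial.C b1 * LaurentPolynomial.C b2) * hT

lemma std14_gam1 : Std14 (Polynomial ℝ ⊗[ℝ] Gamma14 1) (-1) 1 0 := by
  have hI := Complex.I_mul_I
  refine std14_gam 1 1 Complex.I 1 (-Complex.I) (1 / 2) (1 / 2) (-Complex.I / 2) (Complex.I / 2)
    ?_ ?_ ?_ ?_ ?_ ?_ ?_ ?_ (tens14_1 _ (gxh14_rel 1)) ?_ (-1) 1 (Or.inr (by simp))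
  · linear_combination (-1 / 2) * hI
  · linear_combination (1 / 2) * hI
  · ring
  · ring
  · ring
  · linear_combination (-1) * hI
  · linear_combination (1 / 2) * hI
  · linear_combination (-1 / 2) * hI
  · change aeval _ (X 0 ^ 2 + X 1 ^ 2 - 1 : MvPolynomial (Fin 2) ℝ) = 0
    rw [map_sub, map_add, map_pow, map_pow, map_one, aeval_X, aeval_X, sub_eq_zero]
    change Polynomial.C _ ^ 2 + Polynomial.C _ ^ 2 = 1
    rw [← map_pow, ← map_pow, ← map_add, LL14_id _ _ _ _ 1]
    · simp
    · linear_combination (1 / 4) * hI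
    · linear_combination (1 / 4) * hI
    · linear_combination (-1 / 2) * hI

lemma std14_gam2 : Std14 (Polynomial ℝ ⊗[ℝ] Gamma14 2) (-1) (-1) 0 := by
  have hI := Complex.I_mul_I
  refine std14_gam 2 1 Complex.I (-1) Complex.I (1 / 2) (-1 / 2) (-Complex.I / 2) (-Complex.I / 2)
    ?_ ?_ ?_ ?_ ?_ ?_ ?_ ?_ (tens14_2 _ (gxh14_rel 2)) ?_ (-1) (-1) (Or.inr (by simp))
  · linear_combination (-1 / 2) * hI
  · linear_combination (-1 / 2) * hI
  · ring
  · ring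
  · ring
  · linear_combination (-1) * hI
  · linear_combination (-1 / 2) * hI
  · linear_combination (-1 / 2) * hI
  · change aeval _ (X 0 ^ 2 + X 1 ^ 2 + 1 : MvPolynomial (Fin 2) ℝ) = 0
    rw [map_add, map_add, map_pow, map_pow, map_one, aeval_X, aeval_X]
    change Polynomial.C _ ^ 2 + Polynomial.C _ ^ 2 + 1 = (0 : BB14)
    rw [← map_pow, ← map_pow, ← map_add, LL14_id _ _ _ _ (-1)]
    · simp
    · linear_combination (1 / 4) * hI
    · linear_combination (1 / 4) * hI
    · linear_combination (1 / 2) * hI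

end RF14e

noncomputable section RF14f

lemma hom14_scale {R : Type} [CommRing R] [Algebra ℝ R] (c : R) (v : Fin 3 → R)
    (g : MvPolynomial (Fin 3) ℝ) (k : ℕ) (hg : g.IsHomogeneous k) :
    aeval (fun i => c * v i) g = c ^ k * aeval v g := by
  rw [aeval_def, aeval_def, eval₂_eq', eval₂_eq', Finset.mul_sum]
  refine Finset.sum_congr rfl fun d hd => ?_
  have hk : ∑ i, d i = k := by
    rw [← hg (mem_support_iff.1 hd), Finsupp.weight_apply,
      Finsupp.sum_fintype _ _ (fun i => by simp)]
    simp
  simp only [mul_pow, Finset.prod_mul_distrib, Finset.prod_pow_eq_pow_sum, hk]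
  ring

def TB14 (n : ℤ) : BB14 := Polynomial.C (LaurentPolynomial.T n)

lemma TB14_mul (m n : ℤ) : TB14 m * TB14 n = TB14 (m + n) := by
  rw [TB14, TB14, TB14, LaurentPolynomial.T_add, map_mul]

lemma TB14_zero : TB14 0 = 1 := by simp [TB14]

lemma TB14_pow (m : ℤ) (n : ℕ) : TB14 m ^ n = TB14 (n * m) := by
  rw [TB14, TB14, ← map_pow, LaurentPolynomial.T_pow]

def cB14 (z : ℂ) : BB14 := Polynomial.C (LaurentPolynomial.C z)

lemma cB14_mul (z w : ℂ) : cB14 z * cB14 w = cB14 (z * w) := by simp [cB14]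
lemma cB14_add (z w : ℂ) : cB14 z + cB14 w = cB14 (z + w) := by simp [cB14]
lemma cB14_one : cB14 1 = 1 := by simp [cB14]

def hv14 : Fin 3 → BB14 :=
  ![cB14 (1 / 2) * (1 + TB14 (-1)), cB14 (-Complex.I / 2) * (1 - TB14 (-1)), Polynomial.X]

def h14 : MvPolynomial (Fin 3) ℝ →ₐ[ℝ] BB14 := aeval hv14

lemma h14_0 : h14 (X 0) = cB14 (1 / 2) * (1 + TB14 (-1)) := by rw [h14, aeval_X]; rfl
lemma h14_1 : h14 (X 1) = cB14 (-Complex.I / 2) * (1 - TB14 (-1)) := by rw [h14, aeval_X]; rfl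
lemma h14_2 : h14 (X 2) = Polynomial.X := by rw [h14, aeval_X]; rfl

abbrev q14 : MvPolynomial (Fin 3) ℝ := X 0 ^ 2 + X 1 ^ 2

lemma cB_sq1 : cB14 (1 / 2) * cB14 (1 / 2) = cB14 (1 / 4) := by rw [cB14_mul]; norm_num
lemma cB_sq2 : cB14 (-Complex.I / 2) * cB14 (-Complex.I / 2) = - cB14 (1 / 4) := by
  rw [cB14_mul, show -Complex.I / 2 * (-Complex.I / 2) = -(1 / 4) by
    linear_combination (1 / 4) * Complex.I_mul_I]
  simp [cB14]
lemma cB_four : 4 * cB14 (1 / 4) = 1 := by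
  have : (4 : BB14) = cB14 4 := by rw [cB14, map_ofNat, map_ofNat]
  rw [this, cB14_mul]; norm_num [cB14_one]

lemma h14_q : h14 q14 = TB14 (-1) := by
  rw [q14, map_add, map_pow, map_pow, h14_0, h14_1]
  linear_combination (1 + TB14 (-1)) ^ 2 * cB_sq1 + (1 - TB14 (-1)) ^ 2 * cB_sq2
    + TB14 (-1) * cB_four

lemma h14_q_unit : IsUnit (h14 q14) := by
  rw [h14_q]
  exact IsUnit.of_mul_eq_one (TB14 1) (by rw [TB14_mul]; exact TB14_zero)

lemma q14_hom : q14 ∈ homogeneousSubmodule (Fin 3) ℝ 2 := by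
  rw [mem_homogeneousSubmodule, q14]
  exact (isHomogeneous_X_pow _ _).add (isHomogeneous_X_pow _ _)

def f14R : P2MinusConic →+* BB14 :=
  (Localization.awayLift (h14 : MvPolynomial (Fin 3) ℝ →+* BB14) q14 h14_q_unit).comp
    (algebraMap P2MinusConic (Localization.Away q14))

def mk14 (n : ℕ) (g : MvPolynomial (Fin 3) ℝ) (hg : g.IsHomogeneous (n • 2)) : P2MinusConic :=
  HomogeneousLocalization.Away.mk (homogeneousSubmodule (Fin 3) ℝ) q14_hom n g hg

lemma mk14_val (n : ℕ) (g : MvPolynomial (Fin 3) ℝ) (hg : g.IsHomogeneous (n • 2)) :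
    (mk14 n g hg).val = Localization.mk g ⟨q14 ^ n, by use n⟩ := rfl

lemma f14R_mk (n : ℕ) (g : MvPolynomial (Fin 3) ℝ) (hg : g.IsHomogeneous (n • 2)) :
    f14R (mk14 n g hg) = h14 g * TB14 n := by
  have hu : (h14 : MvPolynomial (Fin 3) ℝ →+* BB14) q14 * TB14 1 = 1 := by
    change h14 q14 * TB14 1 = 1
    rw [h14_q, TB14_mul]; exact TB14_zero
  have h := Localization.awayLift_mk (h14 : MvPolynomial (Fin 3) ℝ →+* BB14) q14 g (TB14 1) hu n
  rw [TB14_pow, mul_one] at h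
  exact h

def f14 : P2MinusConic →ₐ[ℝ] BB14 :=
  { f14R with
    commutes' := by
      intro r
      change f14R _ = _
      have : algebraMap ℝ P2MinusConic r = mk14 0 (C r) (by
          simpa using isHomogeneous_C (Fin 3) r) := by
        apply HomogeneousLocalization.val_injective
        rw [mk14_val]
        change Localization.mk _ _ = Localization.mk _ _
        congr 1
      rw [this, f14R_mk]
      simp [TB14_zero, h14] }

lemma f14_mk (n : ℕ) (g : MvPolynomial (Fin 3) ℝ) (hg : g.IsHomogeneous (n • 2)) :
    f14 (mk14 n g hg) = h14 g * TB14 n := f14R_mk n g hg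

lemma mk14_surj (a : P2MinusConic) : ∃ n g hg, mk14 n g hg = a :=
  HomogeneousLocalization.Away.mk_surjective _ q14_hom a

lemma h14_inj (k : ℕ) (g : MvPolynomial (Fin 3) ℝ) (hg : g.IsHomogeneous k) (h : h14 g = 0) :
    g = 0 := by
  have hq : q14 ≠ 0 := by
    intro h0
    have := h14_q_unit
    rw [h0, map_zero] at this
    exact not_isUnit_zero this
  have key : g * q14 = 0 := by
    apply MvPolynomial.funext
    intro p
    rw [map_mul, map_zero]
    by_cases hw : (⟨p 0, p 1⟩ : ℂ) = 0
    · have h0 : p 0 = 0 := congrArg Complex.re hw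
      have h1 : p 1 = 0 := congrArg Complex.im hw
      simp [q14, h0, h1]
    · set w : ℂ := ⟨p 0, p 1⟩ with hwdef
      have hw' : starRingEnd ℂ w ≠ 0 := by simpa using hw
      have hre : w + starRingEnd ℂ w = 2 * p 0 := by
        apply Complex.ext <;> simp [hwdef]; ring
      have him : w - starRingEnd ℂ w = 2 * Complex.I * p 1 := by
        apply Complex.ext <;> simp [hwdef]; ring
      let u : ℂˣ := Units.mk0 w hw * (Units.mk0 _ hw')⁻¹
      let ψ : BB14 →ₐ[ℂ] ℂ := mkHom14 u (w⁻¹ * p 2)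
      have hψT : ψ (TB14 (-1)) = starRingEnd ℂ w * w⁻¹ := by
        simp [ψ, TB14, mkHom14_T, u]
      have hψC : ∀ z, ψ (cB14 z) = z := by
        intro z; simp [ψ, cB14, mkHom14_C]
      have hψX : ψ Polynomial.X = w⁻¹ * p 2 := by simp [ψ, mkHom14_X]
      have hcomp : (ψ.restrictScalars ℝ).comp h14 = aeval (fun i => w⁻¹ * (p i : ℂ)) := by
        apply MvPolynomial.algHom_ext
        intro i
        rw [aeval_X, AlgHom.comp_apply, AlgHom.restrictScalars_apply]
        fin_cases i
        · change ψ (h14 (X 0)) = w⁻¹ * (p 0 : ℂ)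
          rw [h14_0, map_mul, map_add, map_one, hψT, hψC]
          field_simp
          linear_combination hre
        · change ψ (h14 (X 1)) = w⁻¹ * (p 1 : ℂ)
          rw [h14_1, map_mul, map_sub, map_one, hψT, hψC]
          field_simp
          linear_combination -Complex.I * him - 2 * p 1 * Complex.I_mul_I
        · change ψ (h14 (X 2)) = w⁻¹ * (p 2 : ℂ)
          rw [h14_2, hψX]
      have h1 : ψ (h14 g) = aeval (fun i => w⁻¹ * (p i : ℂ)) g := by
        rw [← hcomp]; rfl
      rw [h, map_zero, hom14_scale _ _ _ _ hg] at h1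
      have h2 : aeval (fun i => (p i : ℂ)) g = 0 := by
        rcases mul_eq_zero.1 h1.symm with h | h
        · exact absurd h (pow_ne_zero _ (inv_ne_zero hw))
        · exact h
      have h3 : aeval (fun i => (p i : ℂ)) g = ((eval p g : ℝ) : ℂ) := by
        have := MvPolynomial.aeval_algebraMap_apply (B := ℂ) p g
        simpa [Function.comp_def] using this
      rw [h3] at h2
      rw [Complex.ofReal_eq_zero.1 h2, zero_mul]
  exact (mul_eq_zero.1 key).resolve_right hq

lemma f14_inj : Function.Injective f14 := by
  rw [injective_iff_map_eq_zero]
  intro a ha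
  obtain ⟨n, g, hg, rfl⟩ := mk14_surj a
  rw [f14_mk] at ha
  have : h14 g = 0 := by
    have := congrArg (· * TB14 (-n)) ha
    simpa [mul_assoc, TB14_mul, TB14_zero] using this
  have hg0 := h14_inj _ g hg this
  subst hg0
  apply HomogeneousLocalization.val_injective
  rw [mk14_val, HomogeneousLocalization.val_zero, Localization.mk_zero]

def s14 : BB14 →+* BB14 :=
  Polynomial.eval₂RingHom (Polynomial.C.comp (LaurentPolynomial.eval₂
    (LaurentPolynomial.C.comp (starRingEnd ℂ)) (TU14 ℂ 1)⁻¹)) (TB14 1 * Polynomial.X)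

lemma s14_X : s14 Polynomial.X = TB14 1 * Polynomial.X := by
  simp [s14]

lemma s14_C (z : ℂ) : s14 (cB14 z) = cB14 (starRingEnd ℂ z) := by
  simp [s14, cB14]

lemma s14_T (n : ℤ) : s14 (TB14 n) = TB14 (-n) := by
  have : s14 (TB14 n) = Polynomial.C (((TU14 ℂ 1)⁻¹ ^ n : LL14ˣ) : LL14) := by
    simp [s14, TB14]
  rw [this, inv_zpow, ← zpow_neg, TU14_zpow]
  rfl

lemma s14_h (g : MvPolynomial (Fin 3) ℝ) (k : ℕ) (hg : g.IsHomogeneous k) :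
    s14 (h14 g) = TB14 k * h14 g := by
  have h1 : s14.comp (h14 : MvPolynomial (Fin 3) ℝ →+* BB14) =
      (aeval (fun i => TB14 1 * hv14 i) : MvPolynomial (Fin 3) ℝ →ₐ[ℝ] BB14) := by
    have hT : TB14 1 * TB14 (-1) = 1 := by rw [TB14_mul]; exact TB14_zero
    apply MvPolynomial.ringHom_ext
    · intro r
      have hr : algebraMap ℝ BB14 r = cB14 r := rfl
      simp only [RingHom.comp_apply, RingHom.coe_coe, algHom_C, hr, s14_C, Complex.conj_ofReal]
    · intro i
      simp only [RingHom.comp_apply, RingHom.coe_coe, aeval_X]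
      fin_cases i
      · change s14 (h14 (X 0)) = TB14 1 * (cB14 (1 / 2) * (1 + TB14 (-1)))
        rw [h14_0, map_mul, map_add, map_one, s14_C, s14_T, neg_neg]
        rw [show starRingEnd ℂ (1 / 2) = 1 / 2 by rw [map_div₀, map_one, map_ofNat]]
        linear_combination - cB14 (1 / 2) * hT
      · change s14 (h14 (X 1)) = TB14 1 * (cB14 (-Complex.I / 2) * (1 - TB14 (-1)))
        rw [h14_1, map_mul, map_sub, map_one, s14_C, s14_T, neg_neg]
        rw [show starRingEnd ℂ (-Complex.I / 2) = -(-Complex.I / 2) by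
          rw [map_div₀, map_neg, map_ofNat, Complex.conj_I]; ring,
          show cB14 (-(-Complex.I / 2)) = - cB14 (-Complex.I / 2) by simp [cB14]]
        linear_combination cB14 (-Complex.I / 2) * hT
      · change s14 (h14 (X 2)) = TB14 1 * Polynomial.X
        rw [h14_2, s14_X]
  have h2 := congrArg (fun F : MvPolynomial (Fin 3) ℝ →+* BB14 => F g) h1
  simp only [RingHom.comp_apply, RingHom.coe_coe] at h2
  rw [h2, hom14_scale _ _ _ _ hg, TB14_pow, mul_one]
  rfl

lemma s14_fix (a : P2MinusConic) : s14 (f14 a) = f14 a := by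
  obtain ⟨n, g, hg, rfl⟩ := mk14_surj a
  rw [f14_mk, map_mul, s14_h _ _ hg, s14_T, mul_right_comm, TB14_mul, mul_comm]
  congr 2
  simp
  ring

lemma hx14 (i j : Fin 3) : (X i * X j : MvPolynomial (Fin 3) ℝ).IsHomogeneous (1 • 2) :=
  (isHomogeneous_X ℝ i).mul (isHomogeneous_X ℝ j)

def e14 (i j : Fin 3) : P2MinusConic := mk14 1 (X i * X j) (hx14 i j)

lemma f14_e (i j : Fin 3) : f14 (e14 i j) = h14 (X i) * h14 (X j) * TB14 1 := by
  rw [e14, f14_mk, map_mul]; rfl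

lemma std14_P2 : Std14 P2MinusConic (-1) 1 1 := by
  have hT : TB14 1 * TB14 (-1) = 1 := by rw [TB14_mul]; exact TB14_zero
  have hI : cB14 Complex.I * cB14 (-Complex.I / 2) = cB14 (1 / 2) := by
    rw [cB14_mul]; congr 1; linear_combination (-1 / 2) * Complex.I_mul_I
  have h2 : 2 * cB14 (1 / 2) = 1 := by
    have : (2 : BB14) = cB14 2 := by rw [cB14, map_ofNat, map_ofNat]
    rw [this, cB14_mul]; norm_num [cB14_one]
  have hN : cB14 (-Complex.I) = - cB14 Complex.I := by simp [cB14]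
  have hII : cB14 Complex.I * cB14 Complex.I = -1 := by
    rw [cB14_mul, Complex.I_mul_I]; simp [cB14]
  have hP : h14 (X 0) + cB14 Complex.I * h14 (X 1) = 1 := by
    rw [h14_0, h14_1]
    linear_combination (1 - TB14 (-1)) * hI + h2
  have hM : h14 (X 0) - cB14 Complex.I * h14 (X 1) = TB14 (-1) := by
    rw [h14_0, h14_1]
    linear_combination -(1 - TB14 (-1)) * hI + TB14 (-1) * h2
  have hl : ∀ (z : ℂ) (i j : Fin 3), lift14 f14 (z ⊗ₜ e14 i j) =
      cB14 z * (h14 (X i) * h14 (X j) * TB14 1) := by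
    intro z i j
    rw [lift14_tmul, f14_e]; rfl
  have hm1 : cB14 (-1) = -1 := by simp [cB14]
  refine std14_of_inj f14 f14_inj s14 s14_C s14_fix
    (1 ⊗ₜ e14 0 0 + (-1) ⊗ₜ e14 1 1 + Complex.I ⊗ₜ e14 0 1 + Complex.I ⊗ₜ e14 0 1)
    (1 ⊗ₜ e14 0 0 + (-1) ⊗ₜ e14 1 1 + (-Complex.I) ⊗ₜ e14 0 1 + (-Complex.I) ⊗ₜ e14 0 1)
    (1 ⊗ₜ e14 2 0 + (-Complex.I) ⊗ₜ e14 2 1) ?_ ?_ ?_ (-1) 1 1 ?_ ?_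
  · simp only [map_add, hl, cB14_one, hm1]
    change _ = TB14 1
    linear_combination (h14 (X 0) + cB14 Complex.I * h14 (X 1) + 1) * TB14 1 * hP -
      h14 (X 1) ^ 2 * TB14 1 * hII
  · simp only [map_add, hl, cB14_one, hm1, hN]
    change _ = TB14 (-1)
    linear_combination (h14 (X 0) - cB14 Complex.I * h14 (X 1) + TB14 (-1)) * TB14 1 * hM -
      h14 (X 1) ^ 2 * TB14 1 * hII + TB14 (-1) * hT
  · simp only [map_add, hl, cB14_one, hN, h14_2]
    linear_combination Polynomial.X * TB14 1 * hM + Polynomial.X * hT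
  · rw [show (Polynomial.C (LaurentPolynomial.T 1) : BB14) = TB14 1 from rfl, s14_T]
    simp [mono14, TB14]
  · exact s14_X

end RF14f

/-- The surface `𝔸¹_ℂ × (𝔸¹_ℂ ∖ {0})` has exactly four isomorphism classes of real
forms: `𝔸¹_ℝ × Γᵢ` for `i = 1, 2, 3` and `ℙ²_ℝ ∖ {x² + y² = 0}`. -/
theorem four_real_forms_of_A1_times_A1star :
    (NotIso14 (Polynomial ℝ ⊗[ℝ] Gamma14 0) (Polynomial ℝ ⊗[ℝ] Gamma14 1) ∧
     NotIso14 (Polynomial ℝ ⊗[ℝ] Gamma14 0) (Polynomial ℝ ⊗[ℝ] Gamma14 2) ∧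
     NotIso14 (Polynomial ℝ ⊗[ℝ] Gamma14 0) P2MinusConic ∧
     NotIso14 (Polynomial ℝ ⊗[ℝ] Gamma14 1) (Polynomial ℝ ⊗[ℝ] Gamma14 2) ∧
     NotIso14 (Polynomial ℝ ⊗[ℝ] Gamma14 1) P2MinusConic ∧
     NotIso14 (Polynomial ℝ ⊗[ℝ] Gamma14 2) P2MinusConic) ∧
    (IsRealFormA1Star (Polynomial ℝ ⊗[ℝ] Gamma14 0) ∧
     IsRealFormA1Star (Polynomial ℝ ⊗[ℝ] Gamma14 1) ∧
     IsRealFormA1Star (Polynomial ℝ ⊗[ℝ] Gamma14 2) ∧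
     IsRealFormA1Star P2MinusConic) ∧
    (∀ (A : Type) [CommRing A] [Algebra ℝ A], IsRealFormA1Star A →
      Nonempty (A ≃ₐ[ℝ] Polynomial ℝ ⊗[ℝ] Gamma14 0) ∨
      Nonempty (A ≃ₐ[ℝ] Polynomial ℝ ⊗[ℝ] Gamma14 1) ∨
      Nonempty (A ≃ₐ[ℝ] Polynomial ℝ ⊗[ℝ] Gamma14 2) ∨
      Nonempty (A ≃ₐ[ℝ] P2MinusConic)) := by
  have h0 := std14_gam0
  have h1 := std14_gam1
  have h2 := std14_gam2
  have h3 := std14_P2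
  refine ⟨⟨?_, ?_, ?_, ?_, ?_, ?_⟩, ⟨?_, ?_, ?_, ?_⟩, ?_⟩
  · exact std14_not_iso h0 h1 (by norm_num) (by norm_num) (by norm_num)
  · exact std14_not_iso h0 h2 (by norm_num) (by norm_num) (by norm_num)
  · exact std14_not_iso h0 h3 (by norm_num) (by norm_num) (by norm_num)
  · exact std14_not_iso h1 h2 (by norm_num) (by norm_num) (by norm_num)
  · exact std14_not_iso h1 h3 (by norm_num) (by norm_num) (by simp)
  · exact std14_not_iso h2 h3 (by norm_num) (by norm_num) (by norm_num)
  · obtain ⟨e, _⟩ := h0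
    exact ⟨e.trans isoB14.symm⟩
  · obtain ⟨e, _⟩ := h1
    exact ⟨e.trans isoB14.symm⟩
  · obtain ⟨e, _⟩ := h2
    exact ⟨e.trans isoB14.symm⟩
  · obtain ⟨e, _⟩ := h3
    exact ⟨e.trans isoB14.symm⟩
  · rintro A _ _ ⟨e⟩
    rcases std14_classify (e.trans isoB14) with h | h | h | h
    · exact Or.inl (std14_iso h h0)
    · exact Or.inr (Or.inl (std14_iso h h1))
    · exact Or.inr (Or.inr (Or.inl (std14_iso h h2)))
    · exact Or.inr (Or.inr (Or.inr (std14_iso h h3)))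
end
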